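/- arXiv:2601.14585 — 2 statements merged into one kernel-verified Lean document; each statement's English description precedes it below -/
import Mathlib

section
/- Let S₁(V₁,E₁) and S₂(V₂,E₂) be mutually independent stars. Then the number of linkable pairs (v₁, v₂) with v₁ ∈ V₁ and v₂ ∈ V₂ is odd; moreover, the diagonals corresponding to any two distinct such linkable pairs are crossing. -/
open Complex
open scoped Classical

noncomputable section

/-- The anticlockwise arc displacement from `u` to `v` on the unit circle, lying in `(0, 2π]`
(equal to `2π` when `v = u`). -/
def posArc (u v : ℂ) : ℝ :=
  if 0 < Complex.arg (v / u) then Complex.arg (v / u) else Complex.arg (v / u) + 2 * Real.pi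

/-- `u, v, w` occur in anticlockwise order on the circle. -/
def ACW (u v w : ℂ) : Prop :=
  u ≠ v ∧ v ≠ w ∧ u ≠ w ∧ posArc u v < posArc u w

/-- The open anticlockwise arc from `u` to `v`. -/
def arcOO (u v : ℂ) : Set ℂ := {x | x ≠ u ∧ x ≠ v ∧ posArc u x < posArc u v}

/-- The anticlockwise arc from `u` to `v`, open at `u` and closed at `v`. -/
def arcOC (u v : ℂ) : Set ℂ := {x | x ≠ u ∧ (x = v ∨ posArc u x < posArc u v)}

/-- The closed anticlockwise arc from `u` to `v`. -/
def arcCC (u v : ℂ) : Set ℂ := {x | x = u ∨ x = v ∨ (x ≠ u ∧ posArc u x < posArc u v)}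

/-- The (undirected) angle `∠ x v z` at apex `v`. -/
def vangle (x v z : ℂ) : ℝ := |Complex.arg ((x - v) / (z - v))|

/-- A cyclic polygon: a finite set of vertices on the unit circle together with a set of
directed edges such that every vertex has indegree and outdegree one, and any two
consecutive edges `uv`, `vw` have `u, v, w` in anticlockwise order. -/
structure CyclicPolygon where
  V : Finset ℂ
  E : Finset (ℂ × ℂ)
  nonempty : V.Nonempty
  onCircle : ∀ v ∈ V, ‖v‖ = 1
  endmem : ∀ e ∈ E, e.1 ∈ V ∧ e.2 ∈ V
  outdeg : ∀ v ∈ V, ∃! w, (v, w) ∈ E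
  indeg : ∀ v ∈ V, ∃! u, (u, v) ∈ E
  acw : ∀ u v w : ℂ, (u, v) ∈ E → (v, w) ∈ E → ACW u v w

namespace CyclicPolygon

/-- The successor `v⁺` of a vertex. -/
noncomputable def next (P : CyclicPolygon) (v : ℂ) : ℂ :=
  if h : ∃ w, (v, w) ∈ P.E then h.choose else v

/-- The predecessor `v⁻` of a vertex. -/
noncomputable def prev (P : CyclicPolygon) (v : ℂ) : ℂ :=
  if h : ∃ u, (u, v) ∈ P.E then h.choose else v

end CyclicPolygon

/-- The interior angle `∠ v⁻ v v⁺` of `P` at `v`. -/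
def interiorAngle (P : CyclicPolygon) (v : ℂ) : ℝ :=
  vangle (P.prev v) v (P.next v)

/-- The length of an edge `uv`: the number of vertices on the open anticlockwise
arc from `u` to `v`, plus one. -/
def edgeLength (P : CyclicPolygon) (u v : ℂ) : ℕ :=
  ((P.V : Set ℂ) ∩ arcOO u v).ncard + 1

/-- A `k`-star: a cyclic polygon with `2k+1` vertices all of whose edges have length `k`. -/
def IsKStar (S : CyclicPolygon) (k : ℕ) : Prop :=
  S.V.card = 2 * k + 1 ∧ ∀ e ∈ S.E, edgeLength S e.1 e.2 = k

/-- A star: a `k`-star for some positive integer `k`. -/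
def IsStar (S : CyclicPolygon) : Prop := ∃ k : ℕ, 0 < k ∧ IsKStar S k

/-- The segment from `u` to `x` splits the interior angle `∠ u⁻ u u⁺` of `S` at `u`
into the two (smaller, nonzero) angles `∠ u⁻ u x` and `∠ x u u⁺`. -/
def SplitsVertexAngle (S : CyclicPolygon) (u x : ℂ) : Prop :=
  u ∈ S.V ∧ 0 < vangle (S.prev u) u x ∧ 0 < vangle x u (S.next u) ∧
    vangle (S.prev u) u x + vangle x u (S.next u) = vangle (S.prev u) u (S.next u)

/-- `(u, v)` is a linkable pair for the pair of cyclic polygons `(S₁, S₂)`: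
the segment `uv` splits the angle of `S₁` at `u` and the angle of `S₂` at `v`. -/
def LinkablePair (S₁ S₂ : CyclicPolygon) (u v : ℂ) : Prop :=
  u ≠ v ∧ SplitsVertexAngle S₁ u v ∧ SplitsVertexAngle S₂ v u

/-- `u, v` is a linkable pair of vertices of the cyclic polygon `P`. -/
def Linkable (P : CyclicPolygon) (u v : ℂ) : Prop := LinkablePair P P u v

/-- `D` is a set of (undirected) diagonals of `P`, i.e. every member joins a linkable pair. -/
def IsDiagonalSet (P : CyclicPolygon) (D : Set (Sym2 ℂ)) : Prop :=
  ∀ u v : ℂ, s(u, v) ∈ D → Linkable P u v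

/-- The set `D̃` of directed edges associated to a set of diagonals `D`. -/
def tilde (D : Set (Sym2 ℂ)) : Set (ℂ × ℂ) := {e | s(e.1, e.2) ∈ D}

/-- The segment from `v` towards `x` splits the angle `∠ u v w`. -/
def SplitsAngle3 (u v w x : ℂ) : Prop :=
  0 < vangle u v x ∧ 0 < vangle x v w ∧ vangle u v x + vangle x v w = vangle u v w

/-- `𝒮` is a star decomposition of `P` with respect to the diagonal set `D`: the
cycle decomposition of `E ∪ D̃` determined by `f_next` (each cycle follows the
tightest turn, i.e. no diagonal of `D` splits the angle between two consecutive
edges of a cycle), all of whose cycles are stars. -/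
def IsStarDecomp (P : CyclicPolygon) (D : Set (Sym2 ℂ)) (𝒮 : Finset CyclicPolygon) : Prop :=
  IsDiagonalSet P D ∧
  (∀ S ∈ 𝒮, IsStar S ∧ (S.V : Set ℂ) ⊆ (P.V : Set ℂ)) ∧
  (∀ S ∈ 𝒮, (S.E : Set (ℂ × ℂ)) ⊆ (P.E : Set (ℂ × ℂ)) ∪ tilde D) ∧
  (∀ e ∈ (P.E : Set (ℂ × ℂ)) ∪ tilde D, ∃ S ∈ 𝒮, e ∈ S.E) ∧
  (∀ S₁ ∈ 𝒮, ∀ S₂ ∈ 𝒮, S₁ ≠ S₂ → ∀ e : ℂ × ℂ, e ∈ S₁.E → e ∉ S₂.E) ∧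
  (∀ S ∈ 𝒮, ∀ u v w : ℂ, (u, v) ∈ S.E → (v, w) ∈ S.E →
      ¬ ∃ x, s(v, x) ∈ D ∧ SplitsAngle3 u v w x)

/-- `P` admits a star decomposition with respect to `D`. -/
def HasStarDecomp (P : CyclicPolygon) (D : Set (Sym2 ℂ)) : Prop :=
  ∃ 𝒮 : Finset CyclicPolygon, IsStarDecomp P D 𝒮

/-- A maximal star decomposition: no proper superset of `D` admits a star decomposition. -/
def IsMaximalStarDecomp (P : CyclicPolygon) (D : Set (Sym2 ℂ))
    (𝒮 : Finset CyclicPolygon) : Prop :=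
  IsStarDecomp P D 𝒮 ∧ ∀ D' : Set (Sym2 ℂ), D ⊂ D' → ¬ HasStarDecomp P D'

/-- `D'` is obtained from `D` by a diagonal flip: remove one diagonal and add another. -/
def FlipStep (D D' : Set (Sym2 ℂ)) : Prop :=
  ∃ e f : Sym2 ℂ, e ∈ D ∧ f ∉ D ∧ D' = (D \ {e}) ∪ {f}

/-- The two chords `ab` and `cd` are crossing: they share no endpoint and
intersect inside the circle. -/
def Crossing (a b c d : ℂ) : Prop :=
  a ≠ c ∧ a ≠ d ∧ b ≠ c ∧ b ≠ d ∧ (openSegment ℝ a b ∩ openSegment ℝ c d).Nonempty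

/-- The two chords `ab` and `cd` share a common point: they have a common
endvertex or intersect inside the circle. -/
def ShareCommonPoint (a b c d : ℂ) : Prop :=
  a = c ∨ a = d ∨ b = c ∨ b = d ∨ (openSegment ℝ a b ∩ openSegment ℝ c d).Nonempty

/-- Two cyclic polygons have a pair of overlapped angles: a common vertex `y` and a vertex
`x` of either polygon lying on both arcs `⦅y⁺ y⁻⟧` (taken in each polygon). -/
def OverlappedAngles (S₁ S₂ : CyclicPolygon) : Prop :=
  ∃ y : ℂ, y ∈ S₁.V ∧ y ∈ S₂.V ∧
    ∃ x : ℂ, (x ∈ S₁.V ∨ x ∈ S₂.V) ∧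
      x ∈ arcOC (S₁.next y) (S₁.prev y) ∧ x ∈ arcOC (S₂.next y) (S₂.prev y)

/-- Two cyclic polygons are mutually independent: no two of their angles are overlapped. -/
def IndepPolygons (S₁ S₂ : CyclicPolygon) : Prop := ¬ OverlappedAngles S₁ S₂

/-- The edge `uv` of `P` is minimal: no edge `xy` of `P` has all vertices of the closed
arc from `x` to `y` inside the open arc from `u` to `v`. -/
def MinimalEdge (P : CyclicPolygon) (u v : ℂ) : Prop :=
  (u, v) ∈ P.E ∧
    ¬ ∃ x y : ℂ, (x, y) ∈ P.E ∧ ∀ z ∈ P.V, z ∈ arcCC x y → z ∈ arcOO u v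

/-- `vs` enumerates the star `S` as `v₀ v₁ ⋯ v₂ₖ` with `v₁ = v`, `v₀ = v⁻` (so that `v⁻v`
is an edge of `S`), each edge of `S` is an edge of `P` or a diagonal of `P`, and all the
edges `v₂ᵢ₋₁v₂ᵢ` are edges of `P`. -/
def IsBorderCandidate (P : CyclicPolygon) (v : ℂ) (S : CyclicPolygon) (k : ℕ)
    (vs : ℕ → ℂ) : Prop :=
  0 < k ∧ IsStar S ∧ S.V.card = 2 * k + 1 ∧
  (S.V : Set ℂ) ⊆ (P.V : Set ℂ) ∧
  vs 0 = P.prev v ∧ vs 1 = v ∧ vs (2 * k + 1) = vs 0 ∧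
  (∀ x ∈ S.V, ∃ i ≤ 2 * k, vs i = x) ∧
  (∀ i ≤ 2 * k, (vs i, vs (i + 1)) ∈ S.E) ∧
  (∀ i ≤ 2 * k, (vs i, vs (i + 1)) ∈ P.E ∨ Linkable P (vs i) (vs (i + 1))) ∧
  (∀ i : ℕ, 1 ≤ i → i ≤ k → (vs (2 * i - 1), vs (2 * i)) ∈ P.E)

/-- The angle sequence `(∠v₁v₂v₃, ∠v₃v₄v₅, …, ∠v₂ₖ₋₁v₂ₖv₀)` of an enumerated star. -/
noncomputable def angleList (vs : ℕ → ℂ) (k : ℕ) : List ℝ :=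
  (List.range k).map fun i => vangle (vs (2 * i + 1)) (vs (2 * i + 2)) (vs (2 * i + 3))

/-- `S` is the border star `S*(P, v)`: among all border candidates, its angle sequence is
lexicographically minimal. -/
def IsBorderStar (P : CyclicPolygon) (v : ℂ) (S : CyclicPolygon) : Prop :=
  ∃ (k : ℕ) (vs : ℕ → ℂ), IsBorderCandidate P v S k vs ∧
    ∀ (S' : CyclicPolygon) (k' : ℕ) (vs' : ℕ → ℂ), IsBorderCandidate P v S' k' vs' →
      ¬ List.Lex (· < ·) (angleList vs' k') (angleList vs k)


/-- The point of the unit circle with angular coordinate `x`. -/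
def cpt (x : ℝ) : ℂ := Complex.exp (x * I)

lemma cpt_add (x y : ℝ) : cpt (x + y) = cpt x * cpt y := by
  simp [cpt, add_mul, Complex.exp_add]

lemma cpt_ne_zero (x : ℝ) : cpt x ≠ 0 := Complex.exp_ne_zero _

lemma cpt_two_pi (x : ℝ) : cpt (x + 2 * Real.pi) = cpt x := by
  simp [cpt, add_mul, Complex.exp_add]

lemma cpt_sub_two_pi (x : ℝ) : cpt (x - 2 * Real.pi) = cpt x := by
  rw [← cpt_two_pi (x - 2 * Real.pi)]; congr 1; ring

lemma cpt_int (x : ℝ) (n : ℤ) : cpt (x + n * (2 * Real.pi)) = cpt x := by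
  unfold cpt
  rw [Complex.exp_eq_exp_iff_exists_int]
  exact ⟨n, by push_cast; ring⟩

lemma cpt_eq_iff (x y : ℝ) : cpt x = cpt y ↔ ∃ n : ℤ, x = y + n * (2 * Real.pi) := by
  constructor
  · intro h
    unfold cpt at h
    rw [Complex.exp_eq_exp_iff_exists_int] at h
    obtain ⟨n, hn⟩ := h
    refine ⟨n, ?_⟩
    have h2 : ((x : ℂ) - (y + n * (2 * Real.pi))) * I = 0 := by
      linear_combination hn
    rcases mul_eq_zero.1 h2 with h3 | h3
    · have h4 : ((x - (y + n * (2 * Real.pi)) : ℝ) : ℂ) = 0 := by push_cast; exact h3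
      have := Complex.ofReal_eq_zero.1 h4
      linarith
    · exact absurd h3 I_ne_zero
  · rintro ⟨n, rfl⟩
    exact cpt_int y n

lemma cpt_inj {x y : ℝ} (h : cpt x = cpt y) (h1 : x < y + 2 * Real.pi)
    (h2 : y < x + 2 * Real.pi) : x = y := by
  obtain ⟨n, hn⟩ := (cpt_eq_iff x y).1 h
  have hp := Real.pi_pos
  have a : (n : ℝ) < 1 := by
    by_contra hc
    push Not at hc
    nlinarith
  have b : (-1 : ℝ) < n := by
    by_contra hc
    push Not at hc
    nlinarith
  have a' : n < 1 := by exact_mod_cast a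
  have b' : -1 < n := by exact_mod_cast b
  have : n = 0 := by omega
  subst this
  simpa using hn

lemma cpt_sub (a x : ℝ) : cpt a - cpt x =
    cpt ((a + x) / 2) * ((2 * Real.sin ((a - x) / 2) : ℝ) * I) := by
  have h1 : cpt a = cpt ((a + x) / 2) * cpt ((a - x) / 2) := by
    rw [← cpt_add]; congr 1; ring
  have h2 : cpt x = cpt ((a + x) / 2) * cpt (-((a - x) / 2)) := by
    rw [← cpt_add]; congr 1; ring
  rw [h1, h2]
  have h3 : cpt ((a - x) / 2) = Real.cos ((a - x) / 2) + Real.sin ((a - x) / 2) * I := by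
    unfold cpt; rw [Complex.exp_mul_I]; simp
  have h4 : cpt (-((a - x) / 2)) = Real.cos ((a - x) / 2) - Real.sin ((a - x) / 2) * I := by
    unfold cpt; rw [Complex.exp_mul_I]; push_cast; rw [Complex.cos_neg, Complex.sin_neg]; ring
  rw [h3, h4]; push_cast; ring

lemma arg_cpt {x : ℝ} (h : -Real.pi < x) (h' : x ≤ Real.pi) : Complex.arg (cpt x) = x := by
  unfold cpt
  rw [Complex.exp_mul_I]
  exact Complex.arg_cos_add_sin_mul_I ⟨h, h'⟩

lemma vangle_cpt {a x b : ℝ} (ha : x < a) (ha' : a < x + 2 * Real.pi) (hb : x < b)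
    (hb' : b < x + 2 * Real.pi) : vangle (cpt a) (cpt x) (cpt b) = |a - b| / 2 := by
  have sa : 0 < Real.sin ((a - x) / 2) := Real.sin_pos_of_pos_of_lt_pi (by linarith) (by linarith)
  have sb : 0 < Real.sin ((b - x) / 2) := Real.sin_pos_of_pos_of_lt_pi (by linarith) (by linarith)
  have key : (cpt a - cpt x) / (cpt b - cpt x) =
      ((Real.sin ((a - x) / 2) / Real.sin ((b - x) / 2) : ℝ) : ℂ) * cpt ((a - b) / 2) := by
    rw [cpt_sub, cpt_sub]
    have h1 : cpt ((a + x) / 2) = cpt ((b + x) / 2) * cpt ((a - b) / 2) := by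
      rw [← cpt_add]; congr 1; ring
    rw [h1]
    have n1 := cpt_ne_zero ((b + x) / 2)
    have n2 : ((Real.sin ((b - x) / 2) : ℝ) : ℂ) ≠ 0 := by exact_mod_cast sb.ne'
    have n3 := I_ne_zero
    push_cast at n2 ⊢
    field_simp
  unfold vangle
  rw [key, Complex.arg_real_mul _ (div_pos sa sb), arg_cpt (by linarith) (by linarith), abs_div]
  simp

lemma posArc_cpt {a z : ℝ} (h : a < z) (h' : z ≤ a + 2 * Real.pi) :
    posArc (cpt a) (cpt z) = z - a := by
  have hp := Real.pi_pos
  have hd : cpt z / cpt a = cpt (z - a) := by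
    rw [div_eq_iff (cpt_ne_zero a), ← cpt_add]; congr 1; ring
  unfold posArc
  rw [hd]
  by_cases hc : z - a ≤ Real.pi
  · rw [arg_cpt (by linarith) hc, if_pos (by linarith)]
  · push Not at hc
    rw [← cpt_sub_two_pi (z - a), arg_cpt (by linarith) (by linarith), if_neg (by linarith)]
    ring

lemma arcOO_cpt {a b z : ℝ} (h : a < b) (h' : b < a + 2 * Real.pi)
    (hz : a ≤ z) (hz' : z < a + 2 * Real.pi) :
    cpt z ∈ arcOO (cpt a) (cpt b) ↔ a < z ∧ z < b := by
  unfold arcOO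
  simp only [Set.mem_ofPred_eq]
  constructor
  · rintro ⟨h1, h2, h3⟩
    have : a < z := lt_of_le_of_ne hz (fun h => h1 (by rw [h]))
    rw [posArc_cpt this hz'.le, posArc_cpt h h'.le] at h3
    exact ⟨this, by linarith⟩
  · rintro ⟨h1, h2⟩
    refine ⟨fun hh => ?_, fun hh => ?_, ?_⟩
    · have := cpt_inj hh (by linarith) (by linarith); linarith
    · have := cpt_inj hh (by linarith) (by linarith); linarith
    · rw [posArc_cpt h1 hz'.le, posArc_cpt h h'.le]; linarith

lemma arcOC_cpt {a b z : ℝ} (h' : b < a + 2 * Real.pi)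
    (hz : a < z) (hz' : z ≤ b) :
    cpt z ∈ arcOC (cpt a) (cpt b) := by
  refine ⟨fun hh => ?_, ?_⟩
  · have := cpt_inj hh (by linarith) (by linarith); linarith
  · rcases hz'.eq_or_lt with h | h
    · left; rw [h]
    · right; rw [posArc_cpt hz (by linarith), posArc_cpt (by linarith) h'.le]; linarith

lemma sin_triple (x y z : ℝ) :
    ((Real.sin ((y - x) / 2) * Real.sin ((z - y) / 2) * Real.sin ((z - x) / 2) : ℝ) : ℂ)
      = (cpt y - cpt x) * (cpt z - cpt y) * (cpt z - cpt x)
        / ((2 * I) ^ 3 * (cpt x * cpt y * cpt z)) := by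
  have h : cpt x * cpt y * cpt z
      = cpt ((y + x) / 2) * cpt ((z + y) / 2) * cpt ((z + x) / 2) := by
    simp only [← cpt_add]; congr 1; ring
  rw [h, cpt_sub, cpt_sub, cpt_sub]
  have n1 := cpt_ne_zero ((y + x) / 2)
  have n2 := cpt_ne_zero ((z + y) / 2)
  have n3 := cpt_ne_zero ((z + x) / 2)
  have n4 := I_ne_zero
  push_cast
  field_simp

/-- Two chords with interleaving endpoints cross. -/
lemma cross_cpt {a c b d : ℝ} (h1 : a < c) (h2 : c < b) (h3 : b < d)
    (h4 : d < a + 2 * Real.pi) :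
    (openSegment ℝ (cpt a) (cpt b) ∩ openSegment ℝ (cpt c) (cpt d)).Nonempty := by
  -- positive weights of an affine dependence
  have pos : ∀ x y z : ℝ, a ≤ x → x < y → y < z → z ≤ d →
      0 < Real.sin ((y - x) / 2) * Real.sin ((z - y) / 2) * Real.sin ((z - x) / 2) := by
    intro x y z hx hxy hyz hz
    have s1 := Real.sin_pos_of_pos_of_lt_pi (x := (y - x) / 2) (by linarith) (by linarith)
    have s2 := Real.sin_pos_of_pos_of_lt_pi (x := (z - y) / 2) (by linarith) (by linarith)
    have s3 := Real.sin_pos_of_pos_of_lt_pi (x := (z - x) / 2) (by linarith) (by linarith)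
    positivity
  have pA := pos c b d h1.le h2 h3 le_rfl
  have pB := pos a c d le_rfl h1 (by linarith) le_rfl
  have pC := pos a b d le_rfl (by linarith) h3 le_rfl
  have pD := pos a c b le_rfl h1 h2 h3.le
  have eA := sin_triple c b d
  have eB := sin_triple a c d
  have eC := sin_triple a b d
  have eD := sin_triple a c b
  generalize Real.sin ((b - c) / 2) * Real.sin ((d - b) / 2) * Real.sin ((d - c) / 2) = A at pA eA
  generalize Real.sin ((c - a) / 2) * Real.sin ((d - c) / 2) * Real.sin ((d - a) / 2) = B at pB eB
  generalize Real.sin ((b - a) / 2) * Real.sin ((d - b) / 2) * Real.sin ((d - a) / 2) = C at pC eC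
  generalize Real.sin ((c - a) / 2) * Real.sin ((b - c) / 2) * Real.sin ((b - a) / 2) = D at pD eD
  have na := cpt_ne_zero a
  have nb := cpt_ne_zero b
  have nc := cpt_ne_zero c
  have nd := cpt_ne_zero d
  have nI := I_ne_zero
  have hs : A + B = C + D := by
    have : ((A : ℂ) + B) = C + D := by
      rw [eA, eB, eC, eD]; field_simp; ring
    exact_mod_cast this
  have hv : (A : ℂ) * cpt a + B * cpt b = C * cpt c + D * cpt d := by
    rw [eA, eB, eC, eD]; field_simp; ring
  have hT : 0 < A + B := by positivity
  have hTc : ((A : ℂ) + B) ≠ 0 := by exact_mod_cast hT.ne'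
  refine ⟨(A / (A + B)) • cpt a + (B / (A + B)) • cpt b, ?_, ?_⟩
  · exact ⟨A / (A + B), B / (A + B), by positivity, by positivity, by field_simp, rfl⟩
  · refine ⟨C / (A + B), D / (A + B), by positivity, by positivity, ?_, ?_⟩
    · rw [← add_div, ← hs]; field_simp
    · simp only [Complex.real_smul]
      push_cast
      field_simp
      linear_combination -hv

/-- `t` enumerates (periodically) the angular coordinates of the vertices of a `k`-star. -/
structure StarLift (S : CyclicPolygon) (k : ℕ) (t : ℤ → ℝ) : Prop where
  kpos : 0 < k
  mono : StrictMono t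
  per : ∀ i, t (i + (2 * k + 1)) = t i + 2 * Real.pi
  memV : ∀ z, z ∈ S.V ↔ ∃ i, z = cpt (t i)
  next : ∀ i, S.next (cpt (t i)) = cpt (t (i + k))
  prev : ∀ i, S.prev (cpt (t i)) = cpt (t (i + k + 1))

/-- The periodic enumeration of the coordinates of a finite set of points of the circle. -/
lemma exists_enum (V : Finset ℂ) (hV : ∀ v ∈ V, ‖v‖ = 1) (N : ℕ) (hN : 0 < N) (hc : V.card = N) :
    ∃ t : ℤ → ℝ, StrictMono t ∧ (∀ i, t (i + N) = t i + 2 * Real.pi) ∧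
      ∀ z, z ∈ V ↔ ∃ i, z = cpt (t i) := by
  have hcpt : ∀ v ∈ V, cpt (Complex.arg v) = v := by
    intro v hv
    have := Complex.norm_mul_exp_arg_mul_I v
    rw [hV v hv] at this
    simpa [cpt] using this
  have hW : (V.image Complex.arg).card = N := by
    rw [Finset.card_image_of_injOn, hc]
    intro x hx y hy hxy
    rw [← hcpt x hx, ← hcpt y hy]
    exact congrArg cpt hxy
  set o := (V.image Complex.arg).orderEmbOfFin hW with ho
  have hNz : (0 : ℤ) < N := by exact_mod_cast hN
  have hlt : ∀ i : ℤ, (i % N).toNat < N := by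
    intro i
    have h1 := Int.emod_nonneg i hNz.ne'
    have h2 := Int.emod_lt_of_pos i hNz
    omega
  have hmem : ∀ j, ∃ v ∈ V, Complex.arg v = o j := by
    intro j
    have := Finset.orderEmbOfFin_mem (V.image Complex.arg) hW j
    exact Finset.mem_image.1 this
  have hbd : ∀ j, -Real.pi < o j ∧ o j ≤ Real.pi := by
    intro j
    obtain ⟨v, -, hv⟩ := hmem j
    rw [← hv]
    exact ⟨Complex.neg_pi_lt_arg v, Complex.arg_le_pi v⟩
  let t : ℤ → ℝ := fun i => o ⟨(i % N).toNat, hlt i⟩ + ((i / N : ℤ) : ℝ) * (2 * Real.pi)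
  have tdef : ∀ i, t i = o ⟨(i % N).toNat, hlt i⟩ + ((i / N : ℤ) : ℝ) * (2 * Real.pi) :=
    fun i => rfl
  refine ⟨t, ?_, ?_, ?_⟩
  · refine strictMono_int_of_lt_succ fun i => ?_
    rw [tdef, tdef]
    have h1 := Int.emod_nonneg i hNz.ne'
    have h2 := Int.emod_lt_of_pos i hNz
    have h3 := Int.mul_ediv_add_emod i N
    by_cases hcase : i % N + 1 < N
    · have e1 : (i + 1) / N = i / N ∧ (i + 1) % N = i % N + 1 := by
        rw [Int.ediv_emod_unique hNz]
        refine ⟨by linarith, by linarith, hcase⟩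
      rw [e1.1]
      have : o ⟨(i % N).toNat, hlt i⟩ < o ⟨((i + 1) % N).toNat, hlt (i + 1)⟩ := by
        apply o.strictMono
        rw [Fin.lt_def]
        simp only
        omega
      linarith
    · have e1 : (i + 1) / N = i / N + 1 ∧ (i + 1) % N = 0 := by
        rw [Int.ediv_emod_unique hNz]
        refine ⟨?_, le_rfl, hNz⟩
        have : i % N = N - 1 := by omega
        rw [this] at h3
        linarith
      rw [e1.1]
      have a := (hbd ⟨(i % N).toNat, hlt i⟩).2
      have b := (hbd ⟨((i + 1) % N).toNat, hlt (i + 1)⟩).1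
      push_cast
      linarith
  · intro i
    rw [tdef, tdef]
    have e1 : (i + N) / N = i / N + 1 := Int.add_ediv_of_dvd_right (dvd_refl _) |>.trans (by
      rw [Int.ediv_self hNz.ne'])
    have e2 : (⟨((i + N) % N).toNat, hlt (i + N)⟩ : Fin N) = ⟨(i % N).toNat, hlt i⟩ := by
      simp
    rw [e1, e2]
    push_cast
    ring
  · intro z
    constructor
    · intro hz
      have : Complex.arg z ∈ Set.range o := by
        rw [ho, Finset.range_orderEmbOfFin]
        simp only [Finset.coe_image]
        exact ⟨z, hz, rfl⟩
      obtain ⟨j, hj⟩ := this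
      refine ⟨(j : ℕ), ?_⟩
      have e1 : (((j : ℕ) : ℤ) / N) = 0 := Int.ediv_eq_zero_of_lt (by omega) (by omega)
      have e2 : (⟨((((j : ℕ) : ℤ)) % N).toNat, hlt _⟩ : Fin N) = j := by
        apply Fin.ext
        simp only
        rw [Int.emod_eq_of_lt (by omega) (by omega)]
        simp
      rw [tdef, e1, e2, hj]
      simp [hcpt z hz]
    · rintro ⟨i, rfl⟩
      rw [tdef, cpt_int]
      obtain ⟨v, hv, hv'⟩ := hmem ⟨(i % N).toNat, hlt i⟩
      rw [← hv', hcpt v hv]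
      exact hv

/-- Every point has a coordinate in the sequence in any given window of length one period. -/
lemma enum_window {t : ℤ → ℝ} {N : ℕ} (hN : 0 < N)
    (hper : ∀ i, t (i + N) = t i + 2 * Real.pi) (i m : ℤ) :
    ∃ j, i ≤ j ∧ j < i + N ∧ cpt (t j) = cpt (t m) := by
  have hNz : (0 : ℤ) < N := by exact_mod_cast hN
  have hp : ∀ (n : ℕ) (a : ℤ), cpt (t (a + n * N)) = cpt (t a) := by
    intro n
    induction n with
    | zero => intro a; simp
    | succ n ih =>
      intro a
      have : a + ((n + 1 : ℕ) : ℤ) * N = (a + n * N) + N := by push_cast; ring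
      rw [this, hper, cpt_two_pi, ih]
  have hq : ∀ (n : ℤ) (a : ℤ), cpt (t (a + n * N)) = cpt (t a) := by
    intro n a
    rcases Int.eq_nat_or_neg n with ⟨k, rfl | rfl⟩
    · exact hp k a
    · rw [← hp k (a + -(k : ℤ) * N)]; congr 2; ring
  refine ⟨i + (m - i) % N, ?_, ?_, ?_⟩
  · have := Int.emod_nonneg (m - i) hNz.ne'; omega
  · have := Int.emod_lt_of_pos (m - i) hNz; omega
  · rw [← hq ((m - i) / N) (i + (m - i) % N)]
    congr 2
    have := Int.mul_ediv_add_emod (m - i) N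
    linarith

lemma next_eq (S : CyclicPolygon) {u w : ℂ} (h : (u, w) ∈ S.E) : S.next u = w := by
  have hex : ∃ w, (u, w) ∈ S.E := ⟨w, h⟩
  unfold CyclicPolygon.next
  rw [dif_pos hex]
  exact (S.outdeg u (S.endmem _ h).1).unique hex.choose_spec h

lemma prev_eq (S : CyclicPolygon) {u w : ℂ} (h : (u, w) ∈ S.E) : S.prev w = u := by
  have hex : ∃ u, (u, w) ∈ S.E := ⟨u, h⟩
  unfold CyclicPolygon.prev
  rw [dif_pos hex]
  exact (S.indeg w (S.endmem _ h).2).unique hex.choose_spec h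

lemma exists_lift (S : CyclicPolygon) (h : IsStar S) : ∃ k t, StarLift S k t := by
  obtain ⟨k, hk, hcard, hlen⟩ := h
  obtain ⟨t, hmono, hper, hmem⟩ := exists_enum S.V S.onCircle (2 * k + 1) (by omega) hcard
  have hper' : ∀ i, t (i + (2 * k + 1)) = t i + 2 * Real.pi := by
    intro i; rw [← hper]; push_cast; rfl
  -- the edges
  have hedge : ∀ i, (cpt (t i), cpt (t (i + k))) ∈ S.E := by
    intro i
    obtain ⟨w, hw, -⟩ := S.outdeg (cpt (t i)) ((hmem _).2 ⟨i, rfl⟩)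
    have hwV := (S.endmem _ hw).2
    obtain ⟨w', hw', -⟩ := S.outdeg w hwV
    have hne := (S.acw _ _ _ hw hw').1
    obtain ⟨m, rfl⟩ := (hmem w).1 hwV
    obtain ⟨j, hj1, hj2, hj3⟩ := enum_window (N := 2 * k + 1) (by omega) hper i m
    rw [← hj3] at hw hne
    have hij : i < j := lt_of_le_of_ne hj1 (fun h => hne (by rw [h]))
    have hl := hlen _ hw
    simp only [edgeLength] at hl
    have tij := hmono hij
    have tj : t j < t i + 2 * Real.pi := by rw [← hper]; exact hmono hj2
    have hset : ((S.V : Set ℂ) ∩ arcOO (cpt (t i)) (cpt (t j)))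
        = (((Finset.Ioo i j).image fun a => cpt (t a) : Finset ℂ) : Set ℂ) := by
      ext z
      simp only [Set.mem_inter_iff, Finset.mem_coe, Finset.mem_image, Finset.mem_Ioo]
      constructor
      · rintro ⟨hz, hz'⟩
        obtain ⟨n, rfl⟩ := (hmem z).1 hz
        obtain ⟨a, ha1, ha2, ha3⟩ := enum_window (N := 2 * k + 1) (by omega) hper i n
        rw [← ha3] at hz' ⊢
        rw [arcOO_cpt tij tj (hmono.monotone ha1) (by rw [← hper]; exact hmono ha2)] at hz'
        exact ⟨a, ⟨hmono.lt_iff_lt.1 hz'.1, hmono.lt_iff_lt.1 hz'.2⟩, rfl⟩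
      · rintro ⟨a, ⟨ha1, ha2⟩, rfl⟩
        refine ⟨(hmem _).2 ⟨a, rfl⟩, ?_⟩
        have := hmono ha1
        have := hmono ha2
        rw [arcOO_cpt tij tj (by linarith) (by linarith)]
        constructor <;> assumption
    rw [hset, Set.ncard_coe_finset, Finset.card_image_of_injOn, Int.card_Ioo] at hl
    · have : j = i + k := by omega
      rw [← this]; exact hw
    · intro a ha b hb hab
      simp only [Finset.coe_Ioo, Set.mem_Ioo] at ha hb
      apply hmono.injective
      have h1 := hmono ha.1
      have h2 := hmono ha.2
      have h3 := hmono hb.1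
      have h4 := hmono hb.2
      exact cpt_inj hab (by linarith) (by linarith)
  refine ⟨k, t, hk, hmono, hper', hmem, fun i => next_eq S (hedge i), fun i => ?_⟩
  apply prev_eq
  have := hedge (i + k + 1)
  have e : i + k + 1 + k = i + (2 * k + 1) := by ring
  rw [e, hper', cpt_two_pi] at this
  exact this

lemma StarLift.lt_succ {S k t} (L : StarLift S k t) (i : ℤ) : t i < t (i + k) := by
  have := L.kpos
  exact L.mono (by omega)

lemma StarLift.succ_lt {S k t} (L : StarLift S k t) (i : ℤ) : t (i + k) < t (i + k + 1) :=
  L.mono (by omega)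

lemma StarLift.pred_lt {S k t} (L : StarLift S k t) (i : ℤ) :
    t (i + k + 1) < t i + 2 * Real.pi := by
  have := L.kpos
  rw [← L.per]
  exact L.mono (by omega)

lemma StarLift.per' {S k t} (L : StarLift S k t) (i : ℤ) :
    t (i - (2 * k + 1)) = t i - 2 * Real.pi := by
  have := L.per (i - (2 * k + 1))
  rw [sub_add_cancel] at this
  linarith

lemma StarLift.mem {S k t} (L : StarLift S k t) (i : ℤ) : cpt (t i) ∈ S.V :=
  (L.memV _).2 ⟨i, rfl⟩

lemma splits_iff {S k t} (L : StarLift S k t) {i : ℤ} {y : ℝ} (h1 : t i < y)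
    (h2 : y < t i + 2 * Real.pi) :
    SplitsVertexAngle S (cpt (t i)) (cpt y) ↔ t (i + k) < y ∧ y < t (i + k + 1) := by
  have a1 := L.lt_succ i
  have a2 := L.succ_lt i
  have a3 := L.pred_lt i
  unfold SplitsVertexAngle
  rw [L.next, L.prev, vangle_cpt (by linarith) (by linarith) h1 h2,
    vangle_cpt h1 h2 (by linarith) (by linarith),
    vangle_cpt (by linarith) (by linarith) (by linarith) (by linarith)]
  constructor
  · rintro ⟨-, h3, h4, h5⟩
    have n1 : t (i + k + 1) ≠ y := fun h => by simp [h] at h3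
    have n2 : y ≠ t (i + k) := fun h => by simp [h] at h4
    rw [abs_of_pos (by linarith : 0 < t (i + k + 1) - t (i + k))] at h5
    have b1 := le_abs_self (t (i + k + 1) - y)
    have b2 := neg_le_abs (t (i + k + 1) - y)
    have b3 := le_abs_self (y - t (i + k))
    have b4 := neg_le_abs (y - t (i + k))
    exact ⟨lt_of_le_of_ne (by linarith) n2.symm, lt_of_le_of_ne (by linarith) n1.symm⟩
  · rintro ⟨h3, h4⟩
    rw [abs_of_pos (by linarith : 0 < t (i + k + 1) - y),
      abs_of_pos (by linarith : 0 < y - t (i + k)),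
      abs_of_pos (by linarith : 0 < t (i + k + 1) - t (i + k))]
    exact ⟨L.mem i, by linarith, by linarith, by ring⟩

lemma link_iff {S₁ S₂ k l s t} (L₁ : StarLift S₁ k s) (L₂ : StarLift S₂ l t) {i m : ℤ}
    (h1 : s i < t m) (h2 : t m < s i + 2 * Real.pi) :
    LinkablePair S₁ S₂ (cpt (s i)) (cpt (t m)) ↔
      (s (i + k) < t m ∧ t m < s (i + k + 1)) ∧ (t (m - l - 1) < s i ∧ s i < t (m - l)) := by
  unfold LinkablePair
  have hne : cpt (s i) ≠ cpt (t m) := fun h => by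
    have := cpt_inj h (by linarith) (by linarith); linarith
  rw [splits_iff L₁ h1 h2, ← cpt_two_pi (s i), splits_iff L₂ (by linarith) (by linarith)]
  have e1 : t (m - l - 1) = t (m + l) - 2 * Real.pi := by
    rw [← L₂.per']; congr 1; ring
  have e2 : t (m - l) = t (m + l + 1) - 2 * Real.pi := by
    rw [← L₂.per']; congr 1; ring
  rw [e1, e2]
  constructor
  · rintro ⟨-, h3, h4, h5⟩
    exact ⟨h3, by linarith, by linarith⟩
  · rintro ⟨h3, h4, h5⟩
    rw [cpt_two_pi]
    exact ⟨hne, h3, by linarith, by linarith⟩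

/-- For each real `x` there is an index separating the terms below `x` from the others. -/
lemma exists_idx {S k t} (L : StarLift S k t) (x : ℝ) : ∃ j : ℤ, ∀ m, t m < x ↔ m < j := by
  have hp := Real.pi_pos
  have up : ∀ n : ℕ, t (n * (2 * k + 1)) = t 0 + n * (2 * Real.pi) := by
    intro n
    induction n with
    | zero => simp
    | succ n ih =>
      have : (((n + 1 : ℕ) : ℤ) * (2 * k + 1)) = n * (2 * k + 1) + (2 * k + 1) := by
        push_cast; ring
      rw [this, L.per, ih]; push_cast; ring
  have dn : ∀ n : ℕ, t (-(n * (2 * k + 1))) = t 0 - n * (2 * Real.pi) := by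
    intro n
    induction n with
    | zero => simp
    | succ n ih =>
      have : (-(((n + 1 : ℕ) : ℤ) * (2 * k + 1))) = -(n * (2 * k + 1)) - (2 * k + 1) := by
        push_cast; ring
      rw [this, L.per', ih]; push_cast; ring
  have hinh : ∃ z, x ≤ t z := by
    obtain ⟨n, hn⟩ := exists_nat_ge ((x - t 0) / (2 * Real.pi))
    rw [div_le_iff₀ (by linarith)] at hn
    exact ⟨_, by rw [up n]; linarith⟩
  have hbdd : ∃ b, ∀ z, x ≤ t z → b ≤ z := by
    obtain ⟨n, hn⟩ := exists_nat_gt ((t 0 - x) / (2 * Real.pi))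
    rw [div_lt_iff₀ (by linarith)] at hn
    refine ⟨-(n * (2 * k + 1)), fun z hz => ?_⟩
    rw [← L.mono.le_iff_le, dn n]
    linarith
  obtain ⟨j, hj, hj'⟩ := Int.exists_least_of_bdd hbdd hinh
  refine ⟨j, fun m => ⟨fun h => ?_, fun h => ?_⟩⟩
  · by_contra hc
    push Not at hc
    have := L.mono.monotone hc
    linarith
  · by_contra hc
    push Not at hc
    have := hj' m hc
    omega

/-- Every vertex has a coordinate in the window `[x, x + 2π)`. -/
lemma exists_window {S k t} (L : StarLift S k t) (x : ℝ) {z : ℂ} (hz : z ∈ S.V) :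
    ∃ m, z = cpt (t m) ∧ x ≤ t m ∧ t m < x + 2 * Real.pi := by
  obtain ⟨n, rfl⟩ := (L.memV z).1 hz
  obtain ⟨j, hj⟩ := exists_idx L x
  obtain ⟨m, hm1, hm2, hm3⟩ := enum_window (t := t) (N := 2 * k + 1) (by omega)
    (by intro i; push_cast; exact L.per i) j n
  refine ⟨m, hm3.symm, ?_, ?_⟩
  · by_contra hc
    push Not at hc
    have := (hj m).1 hc
    omega
  · have h1 : t (m - (2 * k + 1)) < x := (hj _).2 (by push_cast at hm2; omega)
    rw [L.per'] at h1
    linarith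

/-- Normal form of linkable pairs. -/
lemma link_form {S₁ S₂ k l s t} (L₁ : StarLift S₁ k s) (L₂ : StarLift S₂ l t) (i : ℤ) {v : ℂ}
    (hv : v ∈ S₂.V) (h : LinkablePair S₁ S₂ (cpt (s i)) v) :
    ∃ m, v = cpt (t m) ∧ (s (i + k) < t m ∧ t m < s (i + k + 1)) ∧
      (t (m - l - 1) < s i ∧ s i < t (m - l)) := by
  obtain ⟨m, rfl, h1, h2⟩ := exists_window L₂ (s i) hv
  have h1' : s i < t m := lt_of_le_of_ne h1 (fun hh => h.1 (by rw [hh]))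
  exact ⟨m, rfl, (link_iff L₁ L₂ h1' h2).1 h⟩

lemma no_overlap {S₁ S₂ k l s t} (L₁ : StarLift S₁ k s) (L₂ : StarLift S₂ l t)
    (hind : IndepPolygons S₁ S₂) {i j : ℤ} (h : s i = t j) (h1 : t (j + l) < s (i + k + 1))
    (h2 : s (i + k) < t (j + l + 1)) : False := by
  apply hind
  have a1 := L₁.lt_succ i
  have a2 := L₁.succ_lt i
  have a3 := L₁.pred_lt i
  have b1 := L₂.lt_succ j
  have b2 := L₂.succ_lt j
  have b3 := L₂.pred_lt j
  refine ⟨cpt (s i), L₁.mem i, h ▸ L₂.mem j, ?_⟩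
  rw [L₁.next, L₁.prev, h, L₂.next, L₂.prev]
  rcases le_total (s (i + k + 1)) (t (j + l + 1)) with hc | hc
  · exact ⟨cpt (s (i + k + 1)), Or.inl (L₁.mem _), arcOC_cpt (by linarith) a2 le_rfl,
      arcOC_cpt (by linarith) h1 hc⟩
  · exact ⟨cpt (t (j + l + 1)), Or.inr (L₂.mem _), arcOC_cpt (by linarith) h2 hc,
      arcOC_cpt (by linarith) b2 le_rfl⟩

lemma sum_shift (f : ℕ → ℕ) (N : ℕ) (hf : ∀ i, f (i + N) = f i) (k : ℕ) :
    ∑ i ∈ Finset.range N, f (i + k) = ∑ i ∈ Finset.range N, f i := by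
  induction k with
  | zero => simp
  | succ k ih =>
    have h1 := Finset.sum_range_succ (fun i => f (i + k)) N
    have h2 := Finset.sum_range_succ' (fun i => f (i + k)) N
    have h3 : f (N + k) = f (0 + k) := by rw [add_comm N k, hf]; simp
    have h4 : ∑ i ∈ Finset.range N, f (i + 1 + k) = ∑ i ∈ Finset.range N, f (i + (k + 1)) :=
      Finset.sum_congr rfl (fun i _ => by congr 1; ring)
    omega

/-- The parity count. -/
lemma odd_count (k : ℕ) (Q R : ℕ → Prop) (hQR : ∀ i, Q i → R i) (hc : ∀ i, Q i ↔ ¬ R (i + k))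
    (hR : ∀ i, R (i + (2 * k + 1)) ↔ R i) :
    Odd ((Finset.range (2 * k + 1)).filter fun i => ¬ Q i ∧ R i).card := by
  rw [Finset.card_filter]
  have h1 := sum_shift (fun i => if R i then 1 else 0) (2 * k + 1) (fun i => by simp only [hR]) k
  have h2 : ∑ i ∈ Finset.range (2 * k + 1), (if ¬ Q i ∧ R i then 1 else 0)
      + ∑ i ∈ Finset.range (2 * k + 1), (if Q i then 1 else 0)
      = ∑ i ∈ Finset.range (2 * k + 1), (if R i then 1 else 0) := by
    rw [← Finset.sum_add_distrib]
    refine Finset.sum_congr rfl fun i _ => ?_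
    have := hQR i
    by_cases a : Q i <;> by_cases b : R i <;> simp_all
  have h3 : ∑ i ∈ Finset.range (2 * k + 1), (if R (i + k) then 1 else 0)
      + ∑ i ∈ Finset.range (2 * k + 1), (if Q i then 1 else 0) = 2 * k + 1 := by
    rw [← Finset.sum_add_distrib]
    rw [Finset.sum_congr rfl (g := fun _ => 1)]
    · simp
    · intro i _
      have := hc i
      by_cases a : Q i <;> by_cases b : R (i + k) <;> simp_all
  rw [Nat.odd_iff]
  omega

lemma linkable_odd {S₁ S₂ k l s t} (L₁ : StarLift S₁ k s) (L₂ : StarLift S₂ l t)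
    (hind : IndepPolygons S₁ S₂) :
    Odd {q : ℂ × ℂ | q.1 ∈ S₁.V ∧ q.2 ∈ S₂.V ∧ LinkablePair S₁ S₂ q.1 q.2}.ncard := by
  choose J hJ using exists_idx L₂
  have hl := L₂.kpos
  have hJ2 : ∀ x, J (x + 2 * Real.pi) = J x + (2 * l + 1) := by
    intro x
    have key : ∀ m, m < J (x + 2 * Real.pi) ↔ m < J x + (2 * l + 1) := by
      intro m
      rw [← hJ, ← sub_lt_iff_lt_add (a := m), ← hJ, L₂.per']
      constructor <;> intro h <;> linarith
    have a := key (J x + (2 * l + 1))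
    have b := key (J (x + 2 * Real.pi))
    omega
  let R : ℤ → Prop := fun i => t (J (s i) + l) < s (i + k + 1)
  let Q : ℤ → Prop := fun i => t (J (s i) + l) < s (i + k)
  have hodd := odd_count k (fun i => Q i) (fun i => R i) ?_ ?_ ?_
  rotate_left
  · intro i h
    exact lt_trans h (L₁.succ_lt i)
  · intro i
    simp only [Q, R]
    have e : ((i + k : ℕ) : ℤ) + k + 1 = i + (2 * k + 1) := by push_cast; ring
    rw [hJ, e, L₁.per, hJ, hJ2]
    push_cast
    omega
  · intro i
    simp only [R]
    have e : ((i + (2 * k + 1) : ℕ) : ℤ) = i + (2 * k + 1) := by push_cast; ring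
    have e2 : (i : ℤ) + (2 * k + 1) + k + 1 = (i + k + 1) + (2 * k + 1) := by ring
    rw [e, e2, L₁.per, L₁.per, hJ, hJ, hJ2, hJ2]
    omega
  have hlow : ∀ x, x ≤ t (J x) := by
    intro x
    by_contra hc
    push Not at hc
    have := (hJ x _).1 hc
    omega
  have hlow' : ∀ x, t (J x - 1) < x := fun x => (hJ x _).2 (by omega)
  -- characterisation of the linkable indices
  have hlink : ∀ i : ℤ, (¬ Q i ∧ R i) →
      LinkablePair S₁ S₂ (cpt (s i)) (cpt (t (J (s i) + l))) := by
    rintro i ⟨hq, hr⟩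
    simp only [Q, R, not_lt] at hq hr
    have a1 := L₁.lt_succ i
    have a2 := L₁.succ_lt i
    have a3 := L₁.pred_lt i
    have b1 := L₂.succ_lt (J (s i))
    rw [link_iff L₁ L₂ (by linarith) (by linarith)]
    refine ⟨⟨lt_of_le_of_ne hq fun hh => ?_, hr⟩, ?_, ?_⟩
    · refine no_overlap L₁ L₂ hind hh ?_ ?_
      · have e : i + k + k + 1 = i + (2 * k + 1) := by ring
        have e2 : J (s i) + l + l = (J (s i) - 1) + (2 * l + 1) := by ring
        rw [e, e2, L₁.per, L₂.per]
        linarith [hlow' (s i)]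
      · have e2 : J (s i) + l + l + 1 = (J (s i)) + (2 * l + 1) := by ring
        have c : s (i + k + k) < s i + 2 * Real.pi := by
          rw [← L₁.per]; exact L₁.mono (by omega)
        rw [e2, L₂.per]
        linarith [hlow (s i)]
    · have e : J (s i) + l - l - 1 = J (s i) - 1 := by ring
      rw [e]; exact hlow' _
    · have e : J (s i) + l - l = J (s i) := by ring
      rw [e]
      refine lt_of_le_of_ne (hlow _) fun hh => ?_
      exact no_overlap L₁ L₂ hind hh hr (by linarith)
  have hset : {q : ℂ × ℂ | q.1 ∈ S₁.V ∧ q.2 ∈ S₂.V ∧ LinkablePair S₁ S₂ q.1 q.2} =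
      ((((Finset.range (2 * k + 1)).filter fun i : ℕ => ¬ Q i ∧ R i).image
        fun i : ℕ => (cpt (s i), cpt (t (J (s i) + l))) : Finset (ℂ × ℂ)) : Set (ℂ × ℂ)) := by
    ext ⟨u, v⟩
    simp only [Set.mem_ofPred_eq, Finset.mem_coe, Finset.mem_image, Finset.mem_filter,
      Finset.mem_range, Prod.mk.injEq]
    constructor
    · rintro ⟨hu, hv, hL⟩
      obtain ⟨n, rfl⟩ := (L₁.memV u).1 hu
      obtain ⟨j, hj1, hj2, hj3⟩ := enum_window (t := s) (N := 2 * k + 1) (by omega)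
        (by intro i; push_cast; exact L₁.per i) 0 n
      rw [← hj3] at hL ⊢
      lift j to ℕ using hj1
      obtain ⟨m, rfl, ⟨h1, h2⟩, h3, h4⟩ := link_form L₁ L₂ j hv hL
      have hm : J (s j) + l = m := by
        rw [hJ] at h3
        have : ¬ (m - l < J (s j)) := by rw [← hJ]; linarith
        omega
      refine ⟨j, ⟨by omega, ?_, ?_⟩, rfl, by rw [hm]⟩
      · simp only [Q, hm, not_lt]; exact h1.le
      · simp only [R, hm]; exact h2
    · rintro ⟨i, ⟨-, h⟩, rfl, rfl⟩
      exact ⟨L₁.mem _, L₂.mem _, hlink i h⟩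
  rw [hset, Set.ncard_coe_finset, Finset.card_image_of_injOn]
  · exact hodd
  · intro a ha b hb hab
    simp only [Finset.coe_filter, Finset.mem_range, Set.mem_ofPred_eq] at ha hb
    have h1 := (Prod.mk.inj hab).1
    have ha' : s a < s b + 2 * Real.pi := by
      rw [← L₁.per]; exact L₁.mono (by omega)
    have hb' : s b < s a + 2 * Real.pi := by
      rw [← L₁.per]; exact L₁.mono (by omega)
    have := L₁.mono.injective (cpt_inj h1 ha' hb')
    exact_mod_cast this

lemma linkable_cross {S₁ S₂ k l s t} (L₁ : StarLift S₁ k s) (L₂ : StarLift S₂ l t)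
    {u v u' v' : ℂ} (hu : u ∈ S₁.V) (hv : v ∈ S₂.V) (hL : LinkablePair S₁ S₂ u v)
    (hu' : u' ∈ S₁.V) (hv' : v' ∈ S₂.V) (hL' : LinkablePair S₁ S₂ u' v')
    (hne : (u, v) ≠ (u', v')) : Crossing u v u' v' := by
  obtain ⟨i, rfl⟩ := (L₁.memV u).1 hu
  obtain ⟨n, rfl⟩ := (L₁.memV u').1 hu'
  obtain ⟨j, hj1, hj2, hj3⟩ := enum_window (t := s) (N := 2 * k + 1) (by omega)
    (by intro i; push_cast; exact L₁.per i) i n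
  rw [← hj3] at hL' hne ⊢
  obtain ⟨m, rfl, ⟨h1, h2⟩, h3, h4⟩ := link_form L₁ L₂ i hv hL
  obtain ⟨m', rfl, ⟨h1', h2'⟩, h3', h4'⟩ := link_form L₁ L₂ j hv' hL'
  have hij : i < j := by
    refine lt_of_le_of_ne hj1 fun hh => ?_
    subst hh
    have a : m - l - 1 < m' - l := L₂.mono.lt_iff_lt.1 (by linarith)
    have b : m' - l - 1 < m - l := L₂.mono.lt_iff_lt.1 (by linarith)
    have : m = m' := by omega
    subst this
    exact hne rfl
  have c1 := L₁.mono hij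
  push_cast at hj2
  have c2 : s j < s i + 2 * Real.pi := by rw [← L₁.per]; exact L₁.mono hj2
  have c3 := L₁.lt_succ i
  have c4 := L₁.pred_lt i
  have c5 := L₁.lt_succ j
  have c6 := L₁.pred_lt j
  rcases le_or_gt j (i + k) with hc | hc
  · have d1 : s j ≤ s (i + k) := L₁.mono.monotone hc
    have d2 : s (i + k + 1) ≤ s (j + k) := L₁.mono.monotone (by omega)
    have d3 : s (j + k + 1) ≤ s i + 2 * Real.pi := by
      rw [← L₁.per]; exact L₁.mono.monotone (by omega)
    refine ⟨?_, ?_, ?_, ?_, cross_cpt c1 (by linarith) (by linarith) (by linarith)⟩ <;>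
    · intro hh
      have := cpt_inj hh (by linarith) (by linarith)
      linarith
  · have d1 : s (i + k + 1) ≤ s j := L₁.mono.monotone (by omega)
    have d2 : s i + 2 * Real.pi ≤ s (j + k) := by
      rw [← L₁.per]; exact L₁.mono.monotone (by omega)
    have d3 : s (j + k + 1) ≤ s (i + k) + 2 * Real.pi := by
      rw [← L₁.per]; exact L₁.mono.monotone (by omega)
    rw [← cpt_sub_two_pi (t m')]
    refine ⟨?_, ?_, ?_, ?_, ?_⟩
    · intro hh
      have := cpt_inj hh (by linarith) (by linarith)
      linarith
    · intro hh
      have := cpt_inj hh (by linarith) (by linarith)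
      linarith
    · intro hh
      have := cpt_inj hh (by linarith) (by linarith)
      linarith
    · intro hh
      have := cpt_inj hh (by linarith) (by linarith)
      linarith
    · rw [openSegment_symm ℝ (cpt (s j))]
      exact cross_cpt (by linarith) (by linarith) (by linarith) (by linarith)

/-- Two mutually independent stars have an odd number of linkable pairs, and
the diagonals of distinct linkable pairs are crossing. -/
theorem linkable_pairs_of_two_stars (S₁ S₂ : CyclicPolygon)
    (h₁ : IsStar S₁) (h₂ : IsStar S₂) (hind : IndepPolygons S₁ S₂) :
    Odd {q : ℂ × ℂ | q.1 ∈ S₁.V ∧ q.2 ∈ S₂.V ∧ LinkablePair S₁ S₂ q.1 q.2}.ncard ∧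
    ∀ q q' : ℂ × ℂ,
      (q.1 ∈ S₁.V ∧ q.2 ∈ S₂.V ∧ LinkablePair S₁ S₂ q.1 q.2) →
      (q'.1 ∈ S₁.V ∧ q'.2 ∈ S₂.V ∧ LinkablePair S₁ S₂ q'.1 q'.2) →
      q ≠ q' → Crossing q.1 q.2 q'.1 q'.2 := by
  obtain ⟨k, s, L₁⟩ := exists_lift S₁ h₁
  obtain ⟨l, t, L₂⟩ := exists_lift S₂ h₂
  refine ⟨linkable_odd L₁ L₂ hind, ?_⟩
  rintro ⟨u, v⟩ ⟨u', v'⟩ ⟨hu, hv, hL⟩ ⟨hu', hv', hL'⟩ hne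
  exact linkable_cross L₁ L₂ hu hv hL hu' hv' hL' hne

end
end

section
/- Let S₁(V₁,E₁) and S₂(V₂,E₂) be mutually independent stars, and let (u₁,u₂) and (v₁,v₂) be two distinct linkable pairs with u₁, v₁ ∈ V₁ and u₂, v₂ ∈ V₂. Then there exist stars S₁'(V₁',E₁') and S₂'(V₂',E₂') with V₁' ∪ V₂' = V₁ ∪ V₂ and E₁' ∪ E₂' = E₁ ∪ E₂ ∪ {u₁u₂, u₂u₁, v₁v₂, v₂v₁}. -/
open Complex
open scoped Classical

noncomputable section

/-! ### Geometry: angular coordinates -/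

lemma posArc_spec (u v : ℂ) (hu : ‖u‖ = 1) (hv : ‖v‖ = 1) :
    0 < posArc u v ∧ posArc u v ≤ 2 * Real.pi ∧ u * Complex.exp (posArc u v * I) = v := by
  have hu0 : u ≠ 0 := by intro h; simp [h] at hu
  have h1 : Complex.exp (Complex.arg (v / u) * I) = v / u := by
    have := Complex.norm_mul_exp_arg_mul_I (v / u)
    simpa [hu, hv] using this
  have h2 := Complex.neg_pi_lt_arg (v / u)
  have h3 := Complex.arg_le_pi (v / u)
  have h4 := Real.pi_pos
  unfold posArc
  split_ifs with h
  · refine ⟨h, by linarith, ?_⟩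
    rw [h1]; field_simp
  · refine ⟨by linarith, by linarith, ?_⟩
    have : ((Complex.arg (v / u) + 2 * Real.pi : ℝ) : ℂ) * I
        = Complex.arg (v / u) * I + 2 * Real.pi * I := by push_cast; ring
    rw [this, Complex.exp_add, Complex.exp_two_pi_mul_I, h1]; field_simp

lemma exp_inj {φ ψ : ℝ} (h : Complex.exp (φ * I) = Complex.exp (ψ * I))
    (h1 : φ - ψ < 2 * Real.pi) (h2 : ψ - φ < 2 * Real.pi) : φ = ψ := by
  rw [Complex.exp_eq_exp_iff_exists_int] at h
  obtain ⟨n, hn⟩ := h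
  have h4 := Real.pi_pos
  have : φ = ψ + n * (2 * Real.pi) := by
    have := congrArg Complex.im hn
    simpa using this
  have hn1 : (n : ℝ) < 1 := by by_contra hc; push Not at hc; nlinarith
  have hn2 : (-1 : ℝ) < n := by by_contra hc; push Not at hc; nlinarith
  have hn1' : n < 1 := by exact_mod_cast hn1
  have hn2' : -1 < n := by exact_mod_cast hn2
  have hn0 : n = 0 := by omega
  subst hn0; simpa using this

lemma posArc_unique {u v : ℂ} (hu : ‖u‖ = 1) (hv : ‖v‖ = 1) {φ : ℝ} (h0 : 0 < φ)
    (h1 : φ ≤ 2 * Real.pi) (h : u * Complex.exp (φ * I) = v) : posArc u v = φ := by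
  have hu0 : u ≠ 0 := by intro h; simp [h] at hu
  obtain ⟨a, b, c⟩ := posArc_spec u v hu hv
  apply exp_inj _ (by linarith) (by linarith)
  exact mul_left_cancel₀ hu0 (c.trans h.symm)

/-- Angular coordinate in `[0, 2π)` with base point `b`. -/
def angT (b x : ℂ) : ℝ := if x = b then 0 else posArc b x

lemma posArc_self (u : ℂ) (hu : ‖u‖ = 1) : posArc u u = 2 * Real.pi := by
  have := Real.pi_pos
  apply posArc_unique hu hu (by linarith) le_rfl
  push_cast
  rw [Complex.exp_two_pi_mul_I, mul_one]

lemma angT_spec (b x : ℂ) (hb : ‖b‖ = 1) (hx : ‖x‖ = 1) :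
    0 ≤ angT b x ∧ angT b x < 2 * Real.pi ∧ b * Complex.exp (angT b x * I) = x := by
  have := Real.pi_pos
  obtain ⟨p, q, r⟩ := posArc_spec b x hb hx
  unfold angT
  split_ifs with h
  · subst h; refine ⟨le_rfl, by linarith, by simp⟩
  · refine ⟨p.le, lt_of_le_of_ne q ?_, r⟩
    intro h'
    rw [h'] at r
    push_cast at r
    rw [Complex.exp_two_pi_mul_I, mul_one] at r
    exact h r.symm

lemma angT_self (b : ℂ) : angT b b = 0 := by simp [angT]

lemma angT_inj {b x y : ℂ} (hb : ‖b‖ = 1) (hx : ‖x‖ = 1) (hy : ‖y‖ = 1)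
    (h : angT b x = angT b y) : x = y := by
  rw [← (angT_spec b x hb hx).2.2, ← (angT_spec b y hb hy).2.2, h]

lemma posArc_lt {b u v : ℂ} (hb : ‖b‖ = 1) (hu : ‖u‖ = 1) (hv : ‖v‖ = 1)
    (h : angT b u < angT b v) : posArc u v = angT b v - angT b u := by
  obtain ⟨p, q, r⟩ := angT_spec b u hb hu
  obtain ⟨p', q', r'⟩ := angT_spec b v hb hv
  apply posArc_unique hu hv (by linarith) (by linarith)
  conv_rhs => rw [← r']
  conv_lhs => enter [1]; rw [← r]
  rw [mul_assoc, ← Complex.exp_add]; congr 2; push_cast; ring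

lemma posArc_ge {b u v : ℂ} (hb : ‖b‖ = 1) (hu : ‖u‖ = 1) (hv : ‖v‖ = 1)
    (h : angT b v ≤ angT b u) : posArc u v = angT b v - angT b u + 2 * Real.pi := by
  obtain ⟨p, q, r⟩ := angT_spec b u hb hu
  obtain ⟨p', q', r'⟩ := angT_spec b v hb hv
  apply posArc_unique hu hv (by linarith) (by linarith)
  conv_rhs => rw [← r']
  conv_lhs => enter [1]; rw [← r]
  rw [mul_assoc, ← Complex.exp_add]
  have : (angT b u : ℂ) * I + ((angT b v - angT b u + 2 * Real.pi : ℝ) : ℂ) * I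
    = angT b v * I + 2 * Real.pi * I := by push_cast; ring
  rw [this, Complex.exp_add, Complex.exp_two_pi_mul_I, mul_one]

/-- Cyclic order in terms of the angular coordinate. -/
lemma posArc_lt_iff {b u v w : ℂ} (hb : ‖b‖ = 1) (hu : ‖u‖ = 1) (hv : ‖v‖ = 1) (hw : ‖w‖ = 1) :
    posArc u v < posArc u w ↔
      (angT b u < angT b v ∧ angT b v < angT b w) ∨
      (angT b v < angT b w ∧ angT b w ≤ angT b u) ∨
      (angT b w ≤ angT b u ∧ angT b u < angT b v) := by
  obtain ⟨p, q, r⟩ := angT_spec b u hb hu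
  obtain ⟨p', q', r'⟩ := angT_spec b v hb hv
  obtain ⟨p'', q'', r''⟩ := angT_spec b w hb hw
  rcases lt_or_ge (angT b u) (angT b v) with h | h <;>
  rcases lt_or_ge (angT b u) (angT b w) with h' | h'
  · rw [posArc_lt hb hu hv h, posArc_lt hb hu hw h']
    constructor
    · intro _; left; constructor <;> linarith
    · rintro (h | h | h) <;> linarith [h.1, h.2]
  · rw [posArc_lt hb hu hv h, posArc_ge hb hu hw h']
    constructor
    · intro _; right; right; constructor <;> linarith
    · rintro (h | h | h) <;> linarith [h.1, h.2]
  · rw [posArc_ge hb hu hv h, posArc_lt hb hu hw h']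
    constructor
    · intro _; linarith
    · rintro (h | h | h) <;> linarith [h.1, h.2]
  · rw [posArc_ge hb hu hv h, posArc_ge hb hu hw h']
    constructor
    · intro _; right; left; constructor <;> linarith
    · rintro (h | h | h) <;> linarith [h.1, h.2]

lemma vangle_eq {u x y : ℂ} (hu : ‖u‖ = 1) (hx : ‖x‖ = 1) (hy : ‖y‖ = 1) (hxu : x ≠ u)
    (hyu : y ≠ u) : vangle x u y = |angT u x - angT u y| / 2 := by
  have hu0 : u ≠ 0 := by intro h; simp [h] at hu
  have key : ∀ z : ℂ, ‖z‖ = 1 → z ≠ u → 0 < Real.sin (angT u z / 2) ∧ 0 < angT u z ∧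
      z - u = u * (2 * I) * (Real.sin (angT u z / 2) : ℝ) * Complex.exp ((angT u z / 2 : ℝ) * I) := by
    intro z hz hzu
    obtain ⟨p, q, r⟩ := angT_spec u z hu hz
    have p' : 0 < angT u z := by
      refine lt_of_le_of_ne p ?_
      intro h; apply hzu
      apply angT_inj hu hz hu; rw [angT_self, h]
    refine ⟨Real.sin_pos_of_pos_of_lt_pi (by linarith) (by linarith), p', ?_⟩
    have e1 : Complex.exp (angT u z * I) = Complex.exp ((angT u z / 2 : ℝ) * I) * Complex.exp ((angT u z / 2 : ℝ) * I) := by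
      rw [← Complex.exp_add]; congr 1; push_cast; ring
    have e2 : Complex.exp (-((angT u z / 2 : ℝ) : ℂ) * I) * Complex.exp ((angT u z / 2 : ℝ) * I) = 1 := by
      rw [← Complex.exp_add, neg_mul, neg_add_cancel, Complex.exp_zero]
    rw [Complex.ofReal_sin, Complex.sin]
    conv_lhs => rw [← r]
    rw [e1]
    linear_combination (u * (1 - 1)) * e2 + u * e2 +
      (u * (Complex.exp ((angT u z / 2 : ℝ) * I)^2 - Complex.exp (-((angT u z / 2 : ℝ) : ℂ) * I) * Complex.exp ((angT u z / 2 : ℝ) * I))) * Complex.I_sq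
  obtain ⟨sx, tx, ex⟩ := key x hx hxu
  obtain ⟨sy, ty, ey⟩ := key y hy hyu
  have qx := (angT_spec u x hu hx).2.1
  have qy := (angT_spec u y hu hy).2.1
  have hpi := Real.pi_pos
  have : (x - u) / (y - u) = ((Real.sin (angT u x / 2) / Real.sin (angT u y / 2) : ℝ) : ℂ) *
      Complex.exp (((angT u x - angT u y) / 2 : ℝ) * I) := by
    have hsy : ((Real.sin (angT u y / 2) : ℝ) : ℂ) ≠ 0 := by exact_mod_cast sy.ne'
    have e3 : Complex.exp ((angT u x / 2 : ℝ) * I) = Complex.exp (((angT u x - angT u y) / 2 : ℝ) * I) * Complex.exp ((angT u y / 2 : ℝ) * I) := by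
      rw [← Complex.exp_add]; congr 1; push_cast; ring
    have hI := Complex.I_ne_zero
    have he := Complex.exp_ne_zero ((angT u y / 2 : ℝ) * I)
    rw [ex, ey, e3, Complex.ofReal_div (Real.sin _) (Real.sin _)]
    generalize ((Real.sin (angT u y / 2) : ℝ) : ℂ) = s1 at hsy ⊢
    generalize ((Real.sin (angT u x / 2) : ℝ) : ℂ) = s2
    field_simp
  unfold vangle
  rw [this, Complex.arg_real_mul _ (by positivity), Complex.arg_exp_mul_I, toIocMod_eq_self Real.two_pi_pos |>.2 (by constructor <;> linarith),
    abs_div, abs_two]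

/-! ### Ranks -/

/-- Number of points of `V` with angular coordinate less than `s`. -/
def rk (b : ℂ) (V : Finset ℂ) (s : ℝ) : ℕ := (V.filter (fun z => angT b z < s)).card

lemma rk_mono (b : ℂ) (V : Finset ℂ) {s s' : ℝ} (h : s ≤ s') : rk b V s ≤ rk b V s' := by
  apply Finset.card_le_card
  intro z
  simp only [Finset.mem_filter]
  rintro ⟨h1, h2⟩
  exact ⟨h1, by linarith⟩

lemma rk_succ {b z : ℂ} {V : Finset ℂ} {s : ℝ} (hz : z ∈ V) (h : angT b z < s) :
    rk b V (angT b z) + 1 ≤ rk b V s := by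
  apply Finset.card_lt_card
  rw [Finset.ssubset_iff_of_subset]
  · exact ⟨z, by simp [hz, h], by simp⟩
  · intro y
    simp only [Finset.mem_filter]
    rintro ⟨h1, h2⟩
    exact ⟨h1, by linarith⟩

lemma rk_le_card (b : ℂ) (V : Finset ℂ) (s : ℝ) : rk b V s ≤ V.card :=
  Finset.card_le_card (Finset.filter_subset _ _)

lemma rk_lt_card {b z : ℂ} {V : Finset ℂ} (hz : z ∈ V) : rk b V (angT b z) + 1 ≤ V.card :=
  (rk_succ hz (lt_add_one _)).trans (rk_le_card b V _)

lemma rk_split (b : ℂ) (V : Finset ℂ) {c s : ℝ} (h : c ≤ s) :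
    rk b V s = rk b V c + (V.filter (fun z => c ≤ angT b z ∧ angT b z < s)).card := by
  unfold rk
  rw [← Finset.card_union_of_disjoint]
  · congr 1
    ext z
    simp only [Finset.mem_filter, Finset.mem_union]
    constructor
    · rintro ⟨h1, h2⟩
      rcases lt_or_ge (angT b z) c with h3 | h3
      · exact Or.inl ⟨h1, h3⟩
      · exact Or.inr ⟨h1, h3, h2⟩
    · rintro (⟨h1, h2⟩ | ⟨h1, h2, h3⟩)
      · exact ⟨h1, by linarith⟩
      · exact ⟨h1, h3⟩
  · rw [Finset.disjoint_left]
    intro z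
    simp only [Finset.mem_filter]
    rintro ⟨h1, h2⟩ ⟨h3, h4, h5⟩
    linarith

lemma rk_agree (b : ℂ) (A V : Finset ℂ) {c s : ℝ} (h : c ≤ s)
    (hAV : ∀ z, c ≤ angT b z → angT b z < s → (z ∈ A ↔ z ∈ V)) :
    rk b A s + rk b V c = rk b A c + rk b V s := by
  rw [rk_split b A h, rk_split b V h]
  have : A.filter (fun z => c ≤ angT b z ∧ angT b z < s)
      = V.filter (fun z => c ≤ angT b z ∧ angT b z < s) := by
    ext z
    simp only [Finset.mem_filter]
    constructor
    · rintro ⟨h1, h2, h3⟩; exact ⟨(hAV z h2 h3).1 h1, h2, h3⟩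
    · rintro ⟨h1, h2, h3⟩; exact ⟨(hAV z h2 h3).2 h1, h2, h3⟩
  rw [this]; ring

lemma rk_agree1 {b p : ℂ} {A V : Finset ℂ} {s : ℝ} (hb : ‖b‖ = 1) (hA : ∀ z ∈ A, ‖z‖ = 1)
    (hV : ∀ z ∈ V, ‖z‖ = 1) (hpA : p ∈ A) (hpV : p ∉ V) (h : angT b p < s)
    (hAV : ∀ z, angT b p < angT b z → angT b z < s → (z ∈ A ↔ z ∈ V)) :
    rk b A s + rk b V (angT b p) = rk b A (angT b p) + rk b V s + 1 := by
  have h1 := rk_agree b A (insert p V) (c := angT b p) h.le (by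
    intro z hz1 hz2
    rw [Finset.mem_insert]
    rcases eq_or_ne z p with e | e
    · subst e; simp [hpA]
    · rcases hz1.lt_or_eq with h3 | h3
      · rw [hAV z h3 hz2]; simp [e]
      · constructor
        · intro hz; exact absurd (angT_inj hb (hA _ hpA) (hA _ hz) h3).symm e
        · rintro (hz | hz)
          · exact absurd hz e
          · exact absurd (angT_inj hb (hA _ hpA) (hV _ hz) h3).symm e)
  have h2 : rk b (insert p V) s = rk b V s + 1 := by
    unfold rk
    rw [Finset.filter_insert, if_pos h, Finset.card_insert_of_notMem]
    simp [hpV]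
  have h3 : rk b (insert p V) (angT b p) = rk b V (angT b p) := by
    unfold rk
    rw [Finset.filter_insert, if_neg (lt_irrefl _)]
  omega

lemma rk_full {b : ℂ} {V : Finset ℂ} (hb : ‖b‖ = 1) (hV : ∀ z ∈ V, ‖z‖ = 1) :
    rk b V (2 * Real.pi) = V.card := by
  unfold rk
  rw [Finset.filter_true_of_mem]
  intro z hz
  exact (angT_spec b z hb (hV z hz)).2.1

lemma rk_inj {b x y : ℂ} {V : Finset ℂ} (hb : ‖b‖ = 1) (hV : ∀ z ∈ V, ‖z‖ = 1) (hx : x ∈ V)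
    (hy : y ∈ V) (h : rk b V (angT b x) = rk b V (angT b y)) : x = y := by
  rcases lt_trichotomy (angT b x) (angT b y) with h1 | h1 | h1
  · have := rk_succ hx h1; omega
  · exact angT_inj hb (hV x hx) (hV y hy) h1
  · have := rk_succ hy h1; omega

lemma rk_lt_iff {b x y : ℂ} {V : Finset ℂ} (hx : x ∈ V) :
    rk b V (angT b x) < rk b V (angT b y) ↔ angT b x < angT b y := by
  constructor
  · intro h
    by_contra hc
    push Not at hc
    have := rk_mono b V hc
    omega
  · intro h
    exact rk_succ hx h

lemma rk_surj {b : ℂ} {V : Finset ℂ} (hb : ‖b‖ = 1) (hV : ∀ z ∈ V, ‖z‖ = 1) {i : ℕ}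
    (hi : i < V.card) : ∃ x ∈ V, rk b V (angT b x) = i := by
  have h1 : V.image (fun x => rk b V (angT b x)) ⊆ Finset.range V.card := by
    intro j hj
    obtain ⟨x, hx, rfl⟩ := Finset.mem_image.1 hj
    exact Finset.mem_range.2 (rk_lt_card hx)
  have h2 : (V.image (fun x => rk b V (angT b x))).card = V.card :=
    Finset.card_image_of_injOn (fun x hx y hy h => rk_inj hb hV hx hy h)
  have h3 := Finset.eq_of_subset_of_card_le h1 (by simp [h2])
  have : i ∈ V.image (fun x => rk b V (angT b x)) := by rw [h3]; exact Finset.mem_range.2 hi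
  obtain ⟨x, hx, e⟩ := Finset.mem_image.1 this
  exact ⟨x, hx, e⟩

lemma arc_card_lt {b x y : ℂ} {V : Finset ℂ} (hb : ‖b‖ = 1) (hV : ∀ z ∈ V, ‖z‖ = 1) (hx : x ∈ V)
    (hy : y ∈ V) (h : angT b x < angT b y) :
    rk b V (angT b x) + (((V : Set ℂ) ∩ arcOO x y).ncard + 1) = rk b V (angT b y) := by
  have e : (V : Set ℂ) ∩ arcOO x y
      = ↑(V.filter (fun z => angT b x < angT b z ∧ angT b z < angT b y)) := by
    ext z
    simp only [Set.mem_inter_iff, Finset.mem_coe, Finset.coe_filter, Set.mem_ofPred_eq, arcOO]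
    constructor
    · rintro ⟨h1, h2, h3, h4⟩
      rw [posArc_lt_iff hb (hV x hx) (hV z h1) (hV y hy)] at h4
      refine ⟨h1, ?_⟩
      rcases h4 with h4 | h4 | h4
      · exact h4
      · linarith [h4.1, h4.2]
      · linarith [h4.1, h4.2]
    · rintro ⟨h1, h2⟩
      refine ⟨h1, ?_, ?_, ?_⟩
      · rintro rfl; linarith [h2.1]
      · rintro rfl; linarith [h2.2]
      · rw [posArc_lt_iff hb (hV x hx) (hV z h1) (hV y hy)]
        exact Or.inl h2
  rw [e, Set.ncard_coe_finset]
  unfold rk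
  have h1 : ∀ p q : ℕ, p + (q + 1) = p + (q + ∑ z ∈ V, if z = x then 1 else 0) := by simp [hx]
  simp only [Finset.card_filter]
  rw [h1]
  rw [← Finset.sum_add_distrib, ← Finset.sum_add_distrib]
  apply Finset.sum_congr rfl
  intro z hz
  rcases lt_trichotomy (angT b z) (angT b x) with h2 | h2 | h2
  · have : z ≠ x := by rintro rfl; linarith
    simp [h2, this, not_lt.2 h2.le, h2.trans h]
  · have := angT_inj hb (hV z hz) (hV x hx) h2
    subst this
    simp [h]
  · have : z ≠ x := by rintro rfl; linarith
    simp [h2, this, not_lt.2 h2.le]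

lemma arc_card_gt {b x y : ℂ} {V : Finset ℂ} (hb : ‖b‖ = 1) (hV : ∀ z ∈ V, ‖z‖ = 1) (hx : x ∈ V)
    (hy : y ∈ V) (h : angT b y < angT b x) :
    rk b V (angT b x) + (((V : Set ℂ) ∩ arcOO x y).ncard + 1) = rk b V (angT b y) + V.card := by
  have e : (V : Set ℂ) ∩ arcOO x y
      = ↑(V.filter (fun z => angT b x < angT b z ∨ angT b z < angT b y)) := by
    ext z
    simp only [Set.mem_inter_iff, Finset.mem_coe, Finset.coe_filter, Set.mem_ofPred_eq, arcOO]
    constructor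
    · rintro ⟨h1, h2, h3, h4⟩
      rw [posArc_lt_iff hb (hV x hx) (hV z h1) (hV y hy)] at h4
      refine ⟨h1, ?_⟩
      rcases h4 with h4 | h4 | h4
      · exact Or.inl h4.1
      · exact Or.inr h4.1
      · exact Or.inl h4.2
    · rintro ⟨h1, h2⟩
      refine ⟨h1, ?_, ?_, ?_⟩
      · rintro rfl; rcases h2 with h2 | h2 <;> linarith
      · rintro rfl; rcases h2 with h2 | h2 <;> linarith
      · rw [posArc_lt_iff hb (hV x hx) (hV z h1) (hV y hy)]
        rcases h2 with h2 | h2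
        · exact Or.inr (Or.inr ⟨h.le, h2⟩)
        · exact Or.inr (Or.inl ⟨h2, h.le⟩)
  rw [e, Set.ncard_coe_finset]
  unfold rk
  have h1 : ∀ p q : ℕ, p + (q + 1) = p + (q + ∑ z ∈ V, if z = x then 1 else 0) := by simp [hx]
  rw [Finset.card_eq_sum_ones V]
  simp only [Finset.card_filter]
  rw [h1]
  rw [← Finset.sum_add_distrib, ← Finset.sum_add_distrib, ← Finset.sum_add_distrib]
  apply Finset.sum_congr rfl
  intro z hz
  rcases lt_trichotomy (angT b z) (angT b x) with h2 | h2 | h2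
  · have : z ≠ x := by rintro rfl; linarith
    by_cases h3 : angT b z < angT b y <;> simp [h2, this, not_lt.2 h2.le, h3]
  · have := angT_inj hb (hV z hz) (hV x hx) h2
    subst this
    simp [not_lt.2 h.le]
  · have : z ≠ x := by rintro rfl; linarith
    simp [h2, this, not_lt.2 h2.le, not_lt.2 (h.trans h2).le]

/-! ### Stars in terms of ranks -/

/-- Rank condition for an edge of a `k`-star. -/
def econd (k i j : ℕ) : Prop := j = i + k ∨ i = j + k + 1

lemma econd_iff {b x y : ℂ} {V : Finset ℂ} {k : ℕ} (hb : ‖b‖ = 1) (hV : ∀ z ∈ V, ‖z‖ = 1)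
    (hx : x ∈ V) (hy : y ∈ V) (hxy : x ≠ y) (hc : V.card = 2 * k + 1) :
    ((V : Set ℂ) ∩ arcOO x y).ncard + 1 = k ↔ econd k (rk b V (angT b x)) (rk b V (angT b y)) := by
  have hx' := rk_lt_card (b := b) hx
  have hy' := rk_lt_card (b := b) hy
  unfold econd
  rcases lt_trichotomy (angT b x) (angT b y) with h | h | h
  · have := arc_card_lt hb hV hx hy h
    omega
  · exact absurd (angT_inj hb (hV x hx) (hV y hy) h) hxy
  · have := arc_card_gt hb hV hx hy h
    have := (rk_lt_iff (b := b) (V := V) (y := x) hy).2 h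
    omega

lemma star_edge {b : ℂ} (hb : ‖b‖ = 1) {S : CyclicPolygon} {k : ℕ} (hS : IsKStar S k) (x y : ℂ) :
    (x, y) ∈ S.E ↔ x ∈ S.V ∧ y ∈ S.V ∧ econd k (rk b S.V (angT b x)) (rk b S.V (angT b y)) := by
  have key : ∀ x y, (x, y) ∈ S.E →
      x ∈ S.V ∧ y ∈ S.V ∧ econd k (rk b S.V (angT b x)) (rk b S.V (angT b y)) := by
    intro x y h
    obtain ⟨hx, hy⟩ := S.endmem _ h
    obtain ⟨w, hw, _⟩ := S.outdeg y hy
    have hxy := (S.acw x y w h hw).1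
    refine ⟨hx, hy, ?_⟩
    rw [← econd_iff hb S.onCircle hx hy hxy hS.1]
    exact hS.2 _ h
  refine ⟨key x y, ?_⟩
  rintro ⟨hx, hy, h⟩
  obtain ⟨w, hw, _⟩ := S.outdeg x hx
  obtain ⟨_, hw2, h'⟩ := key x w hw
  have hy' := rk_lt_card (b := b) hy
  have hw' := rk_lt_card (b := b) hw2
  have hc := hS.1
  have : y = w := by
    apply rk_inj hb S.onCircle hy hw2
    unfold econd at h h'
    omega
  rw [this]; exact hw

lemma mk_star {b : ℂ} (hb : ‖b‖ = 1) (V : Finset ℂ) (hV : ∀ z ∈ V, ‖z‖ = 1) (k : ℕ) (hk : 0 < k)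
    (hc : V.card = 2 * k + 1) : ∃ S : CyclicPolygon, S.V = V ∧ IsStar S ∧ ∀ x y, (x, y) ∈ S.E ↔
      x ∈ V ∧ y ∈ V ∧ econd k (rk b V (angT b x)) (rk b V (angT b y)) := by
  have hE : ∀ x y, (x, y) ∈ (V ×ˢ V).filter
      (fun e => econd k (rk b V (angT b e.1)) (rk b V (angT b e.2))) ↔
      x ∈ V ∧ y ∈ V ∧ econd k (rk b V (angT b x)) (rk b V (angT b y)) := by
    intro x y
    simp only [Finset.mem_filter, Finset.mem_product]
    tauto
  have hne : ∀ x y, econd k (rk b V (angT b x)) (rk b V (angT b y)) → x ≠ y := by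
    rintro x y h rfl
    unfold econd at h
    omega
  refine ⟨⟨V, (V ×ˢ V).filter
      (fun e => econd k (rk b V (angT b e.1)) (rk b V (angT b e.2))), ?_, hV, ?_, ?_, ?_, ?_⟩,
      rfl, ⟨k, hk, hc, ?_⟩, hE⟩
  · rw [← Finset.card_pos]; omega
  · rintro ⟨x, y⟩ h
    rw [hE] at h
    exact ⟨h.1, h.2.1⟩
  · intro v hv
    have hv' := rk_lt_card (b := b) hv
    obtain ⟨w, hw, hr⟩ := rk_surj (b := b) hb hV
      (i := if rk b V (angT b v) ≤ k then rk b V (angT b v) + k else rk b V (angT b v) - k - 1)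
      (by split_ifs <;> omega)
    refine ⟨w, (hE _ _).2 ⟨hv, hw, ?_⟩, ?_⟩
    · unfold econd; rw [hr]; split_ifs <;> omega
    · intro y hy
      obtain ⟨_, hy, h⟩ := (hE _ _).1 hy
      have hy' := rk_lt_card (b := b) hy
      apply rk_inj hb hV hy hw
      rw [hr]; unfold econd at h; split_ifs <;> omega
  · intro v hv
    have hv' := rk_lt_card (b := b) hv
    obtain ⟨w, hw, hr⟩ := rk_surj (b := b) hb hV
      (i := if rk b V (angT b v) < k then rk b V (angT b v) + k + 1 else rk b V (angT b v) - k)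
      (by split_ifs <;> omega)
    refine ⟨w, (hE _ _).2 ⟨hw, hv, ?_⟩, ?_⟩
    · unfold econd; rw [hr]; split_ifs <;> omega
    · intro y hy
      obtain ⟨hy, _, h⟩ := (hE _ _).1 hy
      have hy' := rk_lt_card (b := b) hy
      apply rk_inj hb hV hy hw
      rw [hr]; unfold econd at h; split_ifs <;> omega
  · intro u v w huv hvw
    obtain ⟨hu, hv, h1⟩ := (hE _ _).1 huv
    obtain ⟨_, hw, h2⟩ := (hE _ _).1 hvw
    have hu' := rk_lt_card (b := b) hu
    have hv' := rk_lt_card (b := b) hv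
    have hw' := rk_lt_card (b := b) hw
    refine ⟨hne _ _ h1, hne _ _ h2, ?_, ?_⟩
    · rintro rfl
      unfold econd at h1 h2; omega
    · rw [posArc_lt_iff hb (hV u hu) (hV v hv) (hV w hw)]
      have key : (rk b V (angT b u) < rk b V (angT b v) ∧ rk b V (angT b v) < rk b V (angT b w)) ∨
        (rk b V (angT b v) < rk b V (angT b w) ∧ rk b V (angT b w) < rk b V (angT b u)) ∨
        (rk b V (angT b w) < rk b V (angT b u) ∧ rk b V (angT b u) < rk b V (angT b v)) := by
        unfold econd at h1 h2; omega
      rw [rk_lt_iff hu, rk_lt_iff hv, rk_lt_iff hw] at key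
      rcases key with h | h | h
      · exact Or.inl h
      · exact Or.inr (Or.inl ⟨h.1, h.2.le⟩)
      · exact Or.inr (Or.inr ⟨h.1.le, h.2⟩)
  · rintro ⟨x, y⟩ h
    obtain ⟨hx, hy, h⟩ := (hE _ _).1 h
    exact (econd_iff hb hV hx hy (hne _ _ h) hc).2 h

lemma link_rank {b : ℂ} (hb : ‖b‖ = 1) {S : CyclicPolygon} {k : ℕ} (hk : 0 < k)
    (hS : IsKStar S k) {u x : ℂ} (hx : ‖x‖ = 1) (hux : x ≠ u) (h : SplitsVertexAngle S u x) :
    x ∉ S.V ∧ (rk b S.V (angT b x) = rk b S.V (angT b u) + k + 1 ∨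
      rk b S.V (angT b u) = rk b S.V (angT b x) + k) := by
  obtain ⟨hu, h1, h2, h3⟩ := h
  have hn : (u, S.next u) ∈ S.E := by
    obtain ⟨w, hw, _⟩ := S.outdeg u hu
    have : ∃ w, (u, w) ∈ S.E := ⟨w, hw⟩
    rw [CyclicPolygon.next, dif_pos this]
    exact this.choose_spec
  have hp : (S.prev u, u) ∈ S.E := by
    obtain ⟨w, hw, _⟩ := S.indeg u hu
    have : ∃ w, (w, u) ∈ S.E := ⟨w, hw⟩
    rw [CyclicPolygon.prev, dif_pos this]
    exact this.choose_spec
  generalize S.next u = n at *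
  generalize S.prev u = p at *
  obtain ⟨hpu, hun, hpn, hlt⟩ := S.acw p u n hp hn
  obtain ⟨_, hnV, en⟩ := (star_edge hb hS _ _).1 hn
  obtain ⟨hpV, _, ep⟩ := (star_edge hb hS _ _).1 hp
  have cu := S.onCircle u hu
  have cp := S.onCircle p hpV
  have cn := S.onCircle n hnV
  rw [vangle_eq cu cp hx hpu hux] at h1 h3
  rw [vangle_eq cu hx cn hux hun.symm] at h2 h3
  rw [vangle_eq cu cp cn hpu hun.symm] at h3
  -- order around `u`
  rw [posArc_lt_iff cu cp cu cn, angT_self] at hlt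
  have tp := (angT_spec u p cu cp).1
  have tn := (angT_spec u n cu cn).1
  have tx := (angT_spec u x cu hx).1
  have hnp : angT u n < angT u p := by
    rcases hlt with h | h | h
    · linarith [h.1]
    · rcases h.2.lt_or_eq with h' | h'
      · exact h'
      · exact absurd (angT_inj cu cn cp h').symm hpn
    · rcases h.1.lt_or_eq with h' | h'
      · exact h'
      · exact absurd (angT_inj cu cn cp h').symm hpn
  have hnx : angT u n < angT u x ∧ angT u x < angT u p := by
    have a1 : angT u p - angT u x ≠ 0 := by intro h; simp [h] at h1
    have a2 : angT u x - angT u n ≠ 0 := by intro h; simp [h] at h2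
    rw [abs_of_pos (sub_pos.2 hnp)] at h3
    constructor
    · by_contra hc
      push Not at hc
      rw [abs_of_nonneg (by linarith : 0 ≤ angT u p - angT u x), abs_of_nonpos (by linarith : angT u x - angT u n ≤ 0)] at h3
      apply a2; linarith
    · by_contra hc
      push Not at hc
      rw [abs_of_nonpos (by linarith : angT u p - angT u x ≤ 0), abs_of_nonneg (by linarith : 0 ≤ angT u x - angT u n)] at h3
      apply a1; linarith
  have pa : ∀ z, z ≠ u → angT u z = posArc u z := fun z hz => by simp [angT, hz]
  rw [pa n hun.symm, pa x hux, pa p hpu, posArc_lt_iff hb cu cn hx, posArc_lt_iff hb cu hx cp] at hnx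
  have hu' := rk_lt_card (b := b) hu
  have hn' := rk_lt_card (b := b) hnV
  have hp' := rk_lt_card (b := b) hpV
  have hx' := rk_le_card b S.V (angT b x)
  have hc := hS.1
  have fn := rk_lt_iff (b := b) (y := x) hnV
  have fp := rk_lt_iff (b := b) (y := x) hpV
  have fu := rk_lt_iff (b := b) (y := x) hu
  have gn := rk_lt_iff (b := b) (y := u) hnV
  have gp := rk_lt_iff (b := b) (y := u) hpV
  have gu := rk_lt_iff (b := b) (y := n) hu
  have gu' := rk_lt_iff (b := b) (y := p) hu
  have hxp : angT b x ≠ angT b p := by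
    intro h
    have := angT_inj hb hx cp h
    subst this; simp at h1
  have hxn : angT b x ≠ angT b n := by
    intro h
    have := angT_inj hb hx cn h
    subst this; simp at h2
  have hxu : angT b x ≠ angT b u := by
    intro h
    exact hux (angT_inj hb hx cu h)
  unfold econd at en ep
  simp only [← not_lt] at hnx
  constructor
  · intro hxV
    have f1 := rk_lt_iff (b := b) (y := n) hxV
    have f2 := rk_lt_iff (b := b) (y := p) hxV
    have f3 := rk_lt_iff (b := b) (y := u) hxV
    simp only [← f2, ← fn, ← gu, ← fu, ← gu'] at hnx
    have n1 : rk b S.V (angT b x) ≠ rk b S.V (angT b u) := fun h =>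
      hux (rk_inj hb S.onCircle hxV hu h)
    have n2 := rk_lt_card (b := b) hxV
    omega
  · have lp : angT b x < angT b p →
        rk b S.V (angT b x) ≤ rk b S.V (angT b p) := fun h => rk_mono b _ h.le
    simp only [← fn, ← gu, ← fu, ← gu'] at hnx
    by_cases q : angT b x < angT b p
    · have := lp q
      simp only [q, true_and, and_true, false_and, and_false, false_or, or_false] at hnx
      omega
    · simp only [q, true_and, and_true, false_and, and_false, false_or, or_false] at hnx
      omega

/-! ### The main construction -/

set_option maxHeartbeats 4000000 in
lemma subdiv_main (S₁ S₂ : CyclicPolygon) (h₁ : IsStar S₁) (h₂ : IsStar S₂)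
    (u₁ u₂ v₁ v₂ : ℂ)
    (hu₁ : u₁ ∈ S₁.V) (hu₂ : u₂ ∈ S₂.V) (hv₁ : v₁ ∈ S₁.V) (hv₂ : v₂ ∈ S₂.V)
    (hu : LinkablePair S₁ S₂ u₁ u₂) (hv : LinkablePair S₁ S₂ v₁ v₂)
    (o1 : 0 < angT u₁ v₁) (o2 : angT u₁ v₁ < angT u₁ u₂) (o3 : angT u₁ u₂ < angT u₁ v₂) :
    ∃ S₁' S₂' : CyclicPolygon, IsStar S₁' ∧ IsStar S₂' ∧
      ((S₁'.V : Set ℂ) ∪ (S₂'.V : Set ℂ)) = ((S₁.V : Set ℂ) ∪ (S₂.V : Set ℂ)) ∧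
      ((S₁'.E : Set (ℂ × ℂ)) ∪ (S₂'.E : Set (ℂ × ℂ))) =
        ((S₁.E : Set (ℂ × ℂ)) ∪ (S₂.E : Set (ℂ × ℂ)) ∪
          {(u₁, u₂), (u₂, u₁), (v₁, v₂), (v₂, v₁)}) := by
  obtain ⟨k, hk, hS1⟩ := h₁
  obtain ⟨m, hm, hS2⟩ := h₂
  have hb : ‖u₁‖ = 1 := S₁.onCircle _ hu₁
  have e1 := star_edge hb hS1
  have e2 := star_edge hb hS2
  have c1 := S₁.onCircle
  have c2 := S₂.onCircle
  obtain ⟨hu2n, lu1⟩ := link_rank hb hk hS1 (c2 _ hu₂) hu.1.symm hu.2.1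
  obtain ⟨hu1n, lu2⟩ := link_rank hb hm hS2 (c1 _ hu₁) hu.1 hu.2.2
  obtain ⟨hv2n, lv1⟩ := link_rank hb hk hS1 (c2 _ hv₂) hv.1.symm hv.2.1
  obtain ⟨hv1n, lv2⟩ := link_rank hb hm hS2 (c1 _ hv₁) hv.1 hv.2.2
  have n1 := hS1.1
  have n2 := hS2.1
  generalize S₁.V = V1 at *
  generalize S₂.V = V2 at *
  have tpos : ∀ z, ‖z‖ = 1 → 0 ≤ angT u₁ z := fun z hz => (angT_spec u₁ z hb hz).1
  have tzero : ∀ z, ‖z‖ = 1 → angT u₁ z ≤ 0 → z = u₁ := fun z hz h =>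
    angT_inj hb hz hb (by rw [angT_self]; exact le_antisymm h (tpos z hz))
  have ub : ∀ z, ‖z‖ = 1 → angT u₁ z < 2 * Real.pi := fun z hz => (angT_spec u₁ z hb hz).2.1
  have rz : ∀ V : Finset ℂ, (∀ z ∈ V, ‖z‖ = 1) → rk u₁ V 0 = 0 := by
    intro V hV
    unfold rk
    rw [Finset.card_eq_zero, Finset.filter_eq_empty_iff]
    intro z hz
    exact not_lt.2 (tpos z (hV z hz))
  have r10 := rz V1 c1
  have r20 := rz V2 c2
  rw [angT_self, r10] at lu1
  rw [angT_self, r20] at lu2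
  have f1 := (rk_lt_iff (b := u₁) (y := u₂) hv₁).2 o2
  have f2 := (rk_lt_iff (b := u₁) (y := v₂) hu₂).2 o3
  have f3 := rk_lt_card (b := u₁) hv₁
  have f4 := rk_lt_card (b := u₁) hv₂
  have f5 := rk_succ (b := u₁) (s := angT u₁ v₁) hu₁ (by rw [angT_self]; exact o1)
  rw [angT_self, r10] at f5
  have f6 := rk_le_card u₁ V1 (angT u₁ u₂)
  have f7 := rk_le_card u₁ V1 (angT u₁ v₂)
  obtain ⟨a, ha⟩ : ∃ a, a = rk u₁ V1 (angT u₁ v₁) := ⟨_, rfl⟩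
  obtain ⟨c, hc⟩ : ∃ c, c = rk u₁ V2 (angT u₁ v₁) := ⟨_, rfl⟩
  have g1 : rk u₁ V1 (angT u₁ u₂) = k + 1 := by omega
  have g2 : rk u₁ V2 (angT u₁ u₂) = m := by omega
  have f8 := rk_mono u₁ V1 o3.le
  have f9 := rk_mono u₁ V2 o2.le
  have g3 : rk u₁ V1 (angT u₁ v₂) = a + k + 1 := by omega
  have g4 : rk u₁ V2 (angT u₁ v₂) = c + m := by omega
  have ha1 : 1 ≤ a := by omega
  have hak : a ≤ k := by omega
  have hcm : c ≤ m := by omega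
  have hc1 : 1 ≤ c := by omega
  clear lu1 lu2 lv1 lv2 f1 f2 f3 f4 f5 f6 f7 f8 f9
  -- the two new vertex sets
  obtain ⟨A, hA⟩ : ∃ A : Finset ℂ, ∀ z, z ∈ A ↔
      (z ∈ V1 ∧ (z = u₁ ∨ (angT u₁ v₁ ≤ angT u₁ z ∧ angT u₁ z < angT u₁ u₂) ∨
        angT u₁ v₂ < angT u₁ z)) ∨
      (z ∈ V2 ∧ (angT u₁ z < angT u₁ v₁ ∨ (angT u₁ u₂ ≤ angT u₁ z ∧ angT u₁ z ≤ angT u₁ v₂))) :=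
    ⟨V1.filter (fun z => z = u₁ ∨ (angT u₁ v₁ ≤ angT u₁ z ∧ angT u₁ z < angT u₁ u₂) ∨
        angT u₁ v₂ < angT u₁ z) ∪ V2.filter (fun z => angT u₁ z < angT u₁ v₁ ∨
        (angT u₁ u₂ ≤ angT u₁ z ∧ angT u₁ z ≤ angT u₁ v₂)), fun z => by
      rw [Finset.mem_union, Finset.mem_filter, Finset.mem_filter]⟩
  obtain ⟨B, hB⟩ : ∃ B : Finset ℂ, ∀ z, z ∈ B ↔
      (z ∈ V1 ∧ (angT u₁ z ≤ angT u₁ v₁ ∨ (angT u₁ u₂ < angT u₁ z ∧ angT u₁ z < angT u₁ v₂))) ∨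
      (z ∈ V2 ∧ ((angT u₁ v₁ < angT u₁ z ∧ angT u₁ z ≤ angT u₁ u₂) ∨ angT u₁ v₂ ≤ angT u₁ z)) :=
    ⟨V1.filter (fun z => angT u₁ z ≤ angT u₁ v₁ ∨
        (angT u₁ u₂ < angT u₁ z ∧ angT u₁ z < angT u₁ v₂)) ∪
      V2.filter (fun z => (angT u₁ v₁ < angT u₁ z ∧ angT u₁ z ≤ angT u₁ u₂) ∨
        angT u₁ v₂ ≤ angT u₁ z), fun z => by
      rw [Finset.mem_union, Finset.mem_filter, Finset.mem_filter]⟩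
  have cA : ∀ z ∈ A, ‖z‖ = 1 := by
    intro z hz
    rcases (hA z).1 hz with h | h
    · exact c1 z h.1
    · exact c2 z h.1
  have cB : ∀ z ∈ B, ‖z‖ = 1 := by
    intro z hz
    rcases (hB z).1 hz with h | h
    · exact c1 z h.1
    · exact c2 z h.1
  have rA0 := rz A cA
  have rB0 := rz B cB
  have t0 : angT u₁ u₁ = 0 := angT_self u₁
  -- equality of points from equality of coordinates
  have q1 : ∀ z p, z ∈ V1 → ‖p‖ = 1 → p ∉ V1 → angT u₁ z ≠ angT u₁ p := by
    intro z p hz hp hn h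
    rw [angT_inj hb (c1 z hz) hp h] at hz
    exact hn hz
  have q2 : ∀ z p, z ∈ V2 → ‖p‖ = 1 → p ∉ V2 → angT u₁ z ≠ angT u₁ p := by
    intro z p hz hp hn h
    rw [angT_inj hb (c2 z hz) hp h] at hz
    exact hn hz
  have w1 : ∀ z ∈ V1, z ≠ u₁ → 0 < angT u₁ z := fun z hz h => by
    by_contra hc; exact h (tzero z (c1 z hz) (not_lt.1 hc))
  have w2 : ∀ z ∈ V2, 0 < angT u₁ z := fun z hz => by
    by_contra hc; rw [tzero z (c2 z hz) (not_lt.1 hc)] at hz; exact hu1n hz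
  -- rank formulas for `A`
  have A1 : ∀ s, 0 < s → s ≤ angT u₁ v₁ → rk u₁ A s = 1 + rk u₁ V2 s := by
    intro s h0 hs
    have := rk_agree1 (b := u₁) (p := u₁) (A := A) (V := V2) (s := s) hb cA c2
      ((hA _).2 (Or.inl ⟨hu₁, Or.inl rfl⟩)) hu1n (by rw [t0]; exact h0) (by
        intro z hz1 hz2
        rw [hA]
        rw [t0] at hz1
        constructor
        · rintro (⟨_, h | h | h⟩ | ⟨h, _⟩)
          · rw [h, t0] at hz1; linarith
          · linarith [h.1]
          · linarith
          · exact h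
        · intro h; exact Or.inr ⟨h, Or.inl (by linarith)⟩)
    rw [t0] at this
    omega
  have A1' := A1 _ o1 le_rfl
  have A2 : ∀ s, angT u₁ v₁ ≤ s → s ≤ angT u₁ u₂ → rk u₁ A s + a = 1 + c + rk u₁ V1 s := by
    intro s h0 hs
    have := rk_agree u₁ A V1 h0 (by
        intro z hz1 hz2
        rw [hA]
        constructor
        · rintro (⟨h, _⟩ | ⟨_, h | h⟩)
          · exact h
          · linarith
          · linarith [h.1]
        · intro h; exact Or.inl ⟨h, Or.inr (Or.inl ⟨hz1, by linarith⟩)⟩)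
    omega
  have A2' := A2 _ o2.le le_rfl
  have A3 : ∀ s, angT u₁ u₂ ≤ s → s ≤ angT u₁ v₂ →
      rk u₁ A s + a + m = 2 + c + k + rk u₁ V2 s := by
    intro s h0 hs
    have := rk_agree u₁ A V2 h0 (by
        intro z hz1 hz2
        rw [hA]
        constructor
        · rintro (⟨_, h | h | h⟩ | ⟨h, _⟩)
          · rw [h, t0] at hz1; linarith
          · linarith [h.2]
          · linarith
          · exact h
        · intro h; exact Or.inr ⟨h, Or.inr ⟨hz1, by linarith⟩⟩)
    omega
  have A3' := A3 _ o3.le le_rfl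
  have A4 : ∀ s, angT u₁ v₂ < s → rk u₁ A s + 2 * a = rk u₁ V1 s + 2 + 2 * c := by
    intro s h0
    have := rk_agree1 (b := u₁) (p := v₂) (A := A) (V := V1) (s := s) hb cA c1
      ((hA _).2 (Or.inr ⟨hv₂, Or.inr ⟨o3.le, le_rfl⟩⟩)) hv2n h0 (by
        intro z hz1 hz2
        rw [hA]
        constructor
        · rintro (⟨h, _⟩ | ⟨_, h | h⟩)
          · exact h
          · linarith
          · linarith [h.2]
        · intro h; exact Or.inl ⟨h, Or.inr (Or.inr hz1)⟩)
    omega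
  have nA : A.card = 2 * (k + 1 + c - a) + 1 := by
    have := A4 _ (ub v₂ (c2 _ hv₂))
    rw [rk_full hb cA, rk_full hb c1] at this
    omega
  -- rank formulas for `B`
  have B1 : ∀ s, 0 ≤ s → s ≤ angT u₁ v₁ → rk u₁ B s = rk u₁ V1 s := by
    intro s h0 hs
    have := rk_agree u₁ B V1 h0 (by
        intro z hz1 hz2
        rw [hB]
        constructor
        · rintro (⟨h, _⟩ | ⟨_, h | h⟩)
          · exact h
          · linarith [h.1]
          · linarith
        · intro h; exact Or.inl ⟨h, Or.inl (by linarith)⟩)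
    omega
  have B1' := B1 _ o1.le le_rfl
  have B2 : ∀ s, angT u₁ v₁ < s → s ≤ angT u₁ u₂ → rk u₁ B s + c = a + 1 + rk u₁ V2 s := by
    intro s h0 hs
    have := rk_agree1 (b := u₁) (p := v₁) (A := B) (V := V2) (s := s) hb cB c2
      ((hB _).2 (Or.inl ⟨hv₁, Or.inl le_rfl⟩)) hv1n h0 (by
        intro z hz1 hz2
        rw [hB]
        constructor
        · rintro (⟨_, h | h⟩ | ⟨h, _⟩)
          · linarith
          · linarith [h.1]
          · exact h
        · intro h; exact Or.inr ⟨h, Or.inl ⟨hz1, by linarith⟩⟩)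
    omega
  have B2' := B2 _ o2 le_rfl
  have B3 : ∀ s, angT u₁ u₂ < s → s ≤ angT u₁ v₂ →
      rk u₁ B s + c + k = a + m + 1 + rk u₁ V1 s := by
    intro s h0 hs
    have := rk_agree1 (b := u₁) (p := u₂) (A := B) (V := V1) (s := s) hb cB c1
      ((hB _).2 (Or.inr ⟨hu₂, Or.inl ⟨o2, le_rfl⟩⟩)) hu2n h0 (by
        intro z hz1 hz2
        rw [hB]
        constructor
        · rintro (⟨h, _⟩ | ⟨_, h | h⟩)
          · exact h
          · linarith [h.2]
          · linarith
        · intro h; exact Or.inl ⟨h, Or.inr ⟨hz1, by linarith⟩⟩)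
    omega
  have B3' := B3 _ o3 le_rfl
  have B4 : ∀ s, angT u₁ v₂ ≤ s → rk u₁ B s + 2 * c = 2 * a + 2 + rk u₁ V2 s := by
    intro s h0
    have := rk_agree u₁ B V2 h0 (by
        intro z hz1 hz2
        rw [hB]
        constructor
        · rintro (⟨_, h | h⟩ | ⟨h, _⟩)
          · linarith
          · linarith [h.2]
          · exact h
        · intro h; exact Or.inr ⟨h, Or.inr hz1⟩)
    omega
  have nB : B.card = 2 * (a + 1 + m - c) + 1 := by
    have := B4 _ (ub v₂ (c2 _ hv₂)).le
    rw [rk_full hb cB, rk_full hb c2] at this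
    omega
  -- classification of the points by rank
  have P1 : ∀ z ∈ V1,
      (rk u₁ V1 (angT u₁ z) = 0 ∧ z ∈ A ∧ rk u₁ A (angT u₁ z) = 0 ∧
          z ∈ B ∧ rk u₁ B (angT u₁ z) = 0) ∨
      (0 < rk u₁ V1 (angT u₁ z) ∧ rk u₁ V1 (angT u₁ z) < a ∧ z ∈ B ∧
          rk u₁ B (angT u₁ z) = rk u₁ V1 (angT u₁ z)) ∨
      (rk u₁ V1 (angT u₁ z) = a ∧ z ∈ A ∧ rk u₁ A (angT u₁ z) = 1 + c ∧ z ∈ B ∧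
          rk u₁ B (angT u₁ z) = a) ∨
      (a < rk u₁ V1 (angT u₁ z) ∧ rk u₁ V1 (angT u₁ z) ≤ k ∧ z ∈ A ∧
          rk u₁ A (angT u₁ z) + a = 1 + c + rk u₁ V1 (angT u₁ z)) ∨
      (k < rk u₁ V1 (angT u₁ z) ∧ rk u₁ V1 (angT u₁ z) ≤ a + k ∧ z ∈ B ∧
          rk u₁ B (angT u₁ z) + c + k = a + m + 1 + rk u₁ V1 (angT u₁ z)) ∨
      (a + k < rk u₁ V1 (angT u₁ z) ∧ rk u₁ V1 (angT u₁ z) ≤ 2 * k ∧ z ∈ A ∧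
          rk u₁ A (angT u₁ z) + 2 * a = rk u₁ V1 (angT u₁ z) + 2 + 2 * c) := by
    intro z hz
    have hlt := rk_lt_card (b := u₁) hz
    rcases eq_or_ne z u₁ with h | h
    · left
      subst h
      simp only [t0]
      exact ⟨r10, (hA _).2 (Or.inl ⟨hz, Or.inl rfl⟩), rA0,
        (hB _).2 (Or.inl ⟨hz, Or.inl (by linarith)⟩), rB0⟩
    have hpos := w1 z hz h
    have hpos' := rk_succ (b := u₁) (s := angT u₁ z) hu₁ (by rw [t0]; exact hpos)
    right
    rcases lt_trichotomy (angT u₁ z) (angT u₁ v₁) with h1 | h1 | h1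
    · left
      have := rk_succ hz h1
      exact ⟨by omega, by omega, (hB _).2 (Or.inl ⟨hz, Or.inl h1.le⟩), B1 _ hpos.le h1.le⟩
    · right; left
      have e := angT_inj hb (c1 z hz) (c1 _ hv₁) h1
      subst e
      exact ⟨ha.symm, (hA _).2 (Or.inl ⟨hz, Or.inr (Or.inl ⟨le_rfl, o2⟩)⟩), by omega,
        (hB _).2 (Or.inl ⟨hz, Or.inl le_rfl⟩), by omega⟩
    right; right
    have := rk_succ hv₁ h1
    rcases lt_trichotomy (angT u₁ z) (angT u₁ u₂) with h2 | h2 | h2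
    · left
      have := rk_succ hz h2
      exact ⟨by omega, by omega, (hA _).2 (Or.inl ⟨hz, Or.inr (Or.inl ⟨h1.le, h2⟩)⟩),
        A2 _ h1.le h2.le⟩
    · exact absurd h2 (q1 z u₂ hz (c2 _ hu₂) hu2n)
    right
    have := rk_mono u₁ V1 h2.le
    rcases lt_trichotomy (angT u₁ z) (angT u₁ v₂) with h3 | h3 | h3
    · left
      have := rk_succ hz h3
      exact ⟨by omega, by omega, (hB _).2 (Or.inl ⟨hz, Or.inr ⟨h2, h3⟩⟩), B3 _ h2 h3.le⟩
    · exact absurd h3 (q1 z v₂ hz (c2 _ hv₂) hv2n)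
    right
    have := rk_mono u₁ V1 h3.le
    exact ⟨by omega, by omega, (hA _).2 (Or.inl ⟨hz, Or.inr (Or.inr h3)⟩), A4 _ h3⟩
  have P2 : ∀ z ∈ V2,
      (rk u₁ V2 (angT u₁ z) < c ∧ z ∈ A ∧ rk u₁ A (angT u₁ z) = 1 + rk u₁ V2 (angT u₁ z)) ∨
      (c ≤ rk u₁ V2 (angT u₁ z) ∧ rk u₁ V2 (angT u₁ z) < m ∧ z ∈ B ∧
          rk u₁ B (angT u₁ z) + c = a + 1 + rk u₁ V2 (angT u₁ z)) ∨
      (rk u₁ V2 (angT u₁ z) = m ∧ z ∈ A ∧ rk u₁ A (angT u₁ z) + a = 2 + c + k ∧ z ∈ B ∧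
          rk u₁ B (angT u₁ z) + c = a + 1 + m) ∨
      (m < rk u₁ V2 (angT u₁ z) ∧ rk u₁ V2 (angT u₁ z) < c + m ∧ z ∈ A ∧
          rk u₁ A (angT u₁ z) + a + m = 2 + c + k + rk u₁ V2 (angT u₁ z)) ∨
      (rk u₁ V2 (angT u₁ z) = c + m ∧ z ∈ A ∧ rk u₁ A (angT u₁ z) + a = 2 + 2 * c + k ∧ z ∈ B ∧
          rk u₁ B (angT u₁ z) + c = 2 * a + 2 + m) ∨
      (c + m < rk u₁ V2 (angT u₁ z) ∧ rk u₁ V2 (angT u₁ z) ≤ 2 * m ∧ z ∈ B ∧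
          rk u₁ B (angT u₁ z) + 2 * c = 2 * a + 2 + rk u₁ V2 (angT u₁ z)) := by
    intro z hz
    have hlt := rk_lt_card (b := u₁) hz
    have hpos := w2 z hz
    rcases lt_trichotomy (angT u₁ z) (angT u₁ v₁) with h1 | h1 | h1
    · left
      have := rk_succ hz h1
      exact ⟨by omega, (hA _).2 (Or.inr ⟨hz, Or.inl h1⟩), A1 _ hpos h1.le⟩
    · exact absurd h1 (q2 z v₁ hz (c1 _ hv₁) hv1n)
    right
    have := rk_mono u₁ V2 h1.le
    rcases lt_trichotomy (angT u₁ z) (angT u₁ u₂) with h2 | h2 | h2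
    · left
      have := rk_succ hz h2
      exact ⟨by omega, by omega, (hB _).2 (Or.inr ⟨hz, Or.inl ⟨h1, h2.le⟩⟩), B2 _ h1 h2.le⟩
    · right; left
      have e := angT_inj hb (c2 z hz) (c2 _ hu₂) h2
      subst e
      exact ⟨g2, (hA _).2 (Or.inr ⟨hz, Or.inr ⟨le_rfl, o3.le⟩⟩), by omega,
        (hB _).2 (Or.inr ⟨hz, Or.inl ⟨o2, le_rfl⟩⟩), by omega⟩
    right; right
    have := rk_succ hu₂ h2
    rcases lt_trichotomy (angT u₁ z) (angT u₁ v₂) with h3 | h3 | h3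
    · left
      have := rk_succ hz h3
      exact ⟨by omega, by omega, (hA _).2 (Or.inr ⟨hz, Or.inr ⟨h2.le, h3.le⟩⟩), A3 _ h2.le h3.le⟩
    · right; left
      have e := angT_inj hb (c2 z hz) (c2 _ hv₂) h3
      subst e
      have := B4 _ le_rfl
      exact ⟨g4, (hA _).2 (Or.inr ⟨hz, Or.inr ⟨o3.le, le_rfl⟩⟩), by omega,
        (hB _).2 (Or.inr ⟨hz, Or.inr le_rfl⟩), by omega⟩
    right; right
    have := rk_succ hv₂ h3
    exact ⟨by omega, by omega, (hB _).2 (Or.inr ⟨hz, Or.inr h3.le⟩), B4 _ h3.le⟩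
  have QA : ∀ z ∈ A,
      (z ∈ V1 ∧ rk u₁ V1 (angT u₁ z) = 0 ∧ rk u₁ A (angT u₁ z) = 0) ∨
      (z ∈ V1 ∧ a ≤ rk u₁ V1 (angT u₁ z) ∧ rk u₁ V1 (angT u₁ z) ≤ k ∧
          rk u₁ A (angT u₁ z) + a = 1 + c + rk u₁ V1 (angT u₁ z)) ∨
      (z ∈ V1 ∧ a + k < rk u₁ V1 (angT u₁ z) ∧ rk u₁ V1 (angT u₁ z) ≤ 2 * k ∧
          rk u₁ A (angT u₁ z) + 2 * a = rk u₁ V1 (angT u₁ z) + 2 + 2 * c) ∨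
      (z ∈ V2 ∧ rk u₁ V2 (angT u₁ z) < c ∧ rk u₁ A (angT u₁ z) = 1 + rk u₁ V2 (angT u₁ z)) ∨
      (z ∈ V2 ∧ m ≤ rk u₁ V2 (angT u₁ z) ∧ rk u₁ V2 (angT u₁ z) ≤ c + m ∧
          rk u₁ A (angT u₁ z) + a + m = 2 + c + k + rk u₁ V2 (angT u₁ z)) := by
    intro z hz
    rcases (hA z).1 hz with ⟨h, h' | h' | h'⟩ | ⟨h, h' | h'⟩
    · left; subst h'; rw [t0]; exact ⟨h, r10, rA0⟩
    · right; left
      have := rk_mono u₁ V1 h'.1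
      have := rk_succ h h'.2
      exact ⟨h, by omega, by omega, A2 _ h'.1 h'.2.le⟩
    · right; right; left
      have := rk_mono u₁ V1 h'.le
      have := rk_lt_card (b := u₁) h
      exact ⟨h, by omega, by omega, A4 _ h'⟩
    · right; right; right; left
      have := rk_succ h h'
      exact ⟨h, by omega, A1 _ (w2 z h) h'.le⟩
    · right; right; right; right
      have := rk_mono u₁ V2 h'.1
      have := rk_mono u₁ V2 h'.2
      exact ⟨h, by omega, by omega, A3 _ h'.1 h'.2⟩
  have QB : ∀ z ∈ B,
      (z ∈ V1 ∧ rk u₁ V1 (angT u₁ z) ≤ a ∧ rk u₁ B (angT u₁ z) = rk u₁ V1 (angT u₁ z)) ∨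
      (z ∈ V1 ∧ k < rk u₁ V1 (angT u₁ z) ∧ rk u₁ V1 (angT u₁ z) ≤ a + k ∧
          rk u₁ B (angT u₁ z) + c + k = a + m + 1 + rk u₁ V1 (angT u₁ z)) ∨
      (z ∈ V2 ∧ c ≤ rk u₁ V2 (angT u₁ z) ∧ rk u₁ V2 (angT u₁ z) ≤ m ∧
          rk u₁ B (angT u₁ z) + c = a + 1 + rk u₁ V2 (angT u₁ z)) ∨
      (z ∈ V2 ∧ c + m ≤ rk u₁ V2 (angT u₁ z) ∧ rk u₁ V2 (angT u₁ z) ≤ 2 * m ∧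
          rk u₁ B (angT u₁ z) + 2 * c = 2 * a + 2 + rk u₁ V2 (angT u₁ z)) := by
    intro z hz
    rcases (hB z).1 hz with ⟨h, h' | h'⟩ | ⟨h, h' | h'⟩
    · left
      have := rk_mono u₁ V1 h'
      exact ⟨h, by omega, B1 _ (tpos z (c1 z h)) h'⟩
    · right; left
      have := rk_mono u₁ V1 h'.1.le
      have := rk_succ h h'.2
      exact ⟨h, by omega, by omega, B3 _ h'.1 h'.2.le⟩
    · right; right; left
      have := rk_mono u₁ V2 h'.1.le
      have := rk_mono u₁ V2 h'.2
      exact ⟨h, by omega, by omega, B2 _ h'.1 h'.2⟩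
    · right; right; right
      have := rk_mono u₁ V2 h'
      have := rk_lt_card (b := u₁) h
      exact ⟨h, by omega, by omega, B4 _ h'⟩
  obtain ⟨N, hN⟩ : ∃ N, N + a = k + 1 + c := ⟨k + 1 + c - a, by omega⟩
  obtain ⟨M, hM⟩ : ∃ M, M + c = a + 1 + m := ⟨a + 1 + m - c, by omega⟩
  obtain ⟨SA, sa1, sa2, sa3⟩ := mk_star hb A cA N (by omega) (by omega)
  obtain ⟨SB, sb1, sb2, sb3⟩ := mk_star hb B cB M (by omega) (by omega)
  clear nA nB
  refine ⟨SA, SB, sa2, sb2, ?_, ?_⟩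
  · rw [sa1, sb1]
    ext z
    simp only [Set.mem_union, Finset.mem_coe]
    constructor
    · rintro (h | h)
      · rcases (hA z).1 h with h | h
        · exact Or.inl h.1
        · exact Or.inr h.1
      · rcases (hB z).1 h with h | h
        · exact Or.inl h.1
        · exact Or.inr h.1
    · rintro (h | h)
      · have := P1 z h; tauto
      · have := P2 z h; tauto
  -- recognizing the special points by their ranks
  have s1 : ∀ z, z ∈ V1 → rk u₁ V1 (angT u₁ z) = 0 → z = u₁ := fun z hz h =>
    rk_inj hb c1 hz hu₁ (by rw [h, t0, r10])
  have s2 : ∀ z, z ∈ V1 → rk u₁ V1 (angT u₁ z) = a → z = v₁ := fun z hz h =>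
    rk_inj hb c1 hz hv₁ (by rw [h, ha])
  have s3 : ∀ z, z ∈ V2 → rk u₁ V2 (angT u₁ z) = m → z = u₂ := fun z hz h =>
    rk_inj hb c2 hz hu₂ (by rw [h, g2])
  have s4 : ∀ z, z ∈ V2 → rk u₁ V2 (angT u₁ z) = c + m → z = v₂ := fun z hz h =>
    rk_inj hb c2 hz hv₂ (by rw [h, g4])
  clear hA hB A1 A2 A3 A4 B1 B2 B3 B4
  ext ⟨x, y⟩
  simp only [Set.mem_union, Finset.mem_coe, Set.mem_insert_iff, Set.mem_singleton_iff,
    Prod.mk.injEq, sa3, sb3, e1, e2, econd]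
  constructor
  · have fin : ((x ∈ V1 ∧ y ∈ V1 ∧ (rk u₁ V1 (angT u₁ y) = rk u₁ V1 (angT u₁ x) + k ∨
          rk u₁ V1 (angT u₁ x) = rk u₁ V1 (angT u₁ y) + k + 1)) ∨
        (x ∈ V2 ∧ y ∈ V2 ∧ (rk u₁ V2 (angT u₁ y) = rk u₁ V2 (angT u₁ x) + m ∨
          rk u₁ V2 (angT u₁ x) = rk u₁ V2 (angT u₁ y) + m + 1)) ∨
        (x ∈ V1 ∧ y ∈ V2 ∧ ((rk u₁ V1 (angT u₁ x) = 0 ∧ rk u₁ V2 (angT u₁ y) = m) ∨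
          (rk u₁ V1 (angT u₁ x) = a ∧ rk u₁ V2 (angT u₁ y) = c + m))) ∨
        (x ∈ V2 ∧ y ∈ V1 ∧ ((rk u₁ V2 (angT u₁ x) = m ∧ rk u₁ V1 (angT u₁ y) = 0) ∨
          (rk u₁ V2 (angT u₁ x) = c + m ∧ rk u₁ V1 (angT u₁ y) = a)))) → 
        (x ∈ V1 ∧ y ∈ V1 ∧ (rk u₁ V1 (angT u₁ y) = rk u₁ V1 (angT u₁ x) + k ∨
          rk u₁ V1 (angT u₁ x) = rk u₁ V1 (angT u₁ y) + k + 1) ∨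
        x ∈ V2 ∧ y ∈ V2 ∧ (rk u₁ V2 (angT u₁ y) = rk u₁ V2 (angT u₁ x) + m ∨
          rk u₁ V2 (angT u₁ x) = rk u₁ V2 (angT u₁ y) + m + 1)) ∨
        x = u₁ ∧ y = u₂ ∨ x = u₂ ∧ y = u₁ ∨ x = v₁ ∧ y = v₂ ∨ x = v₂ ∧ y = v₁ := by
      rintro (h | h | ⟨hx, hy, h | h⟩ | ⟨hx, hy, h | h⟩)
      · exact Or.inl (Or.inl h)
      · exact Or.inl (Or.inr h)
      · exact Or.inr (Or.inl ⟨s1 x hx h.1, s3 y hy h.2⟩)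
      · exact Or.inr (Or.inr (Or.inr (Or.inl ⟨s2 x hx h.1, s4 y hy h.2⟩)))
      · exact Or.inr (Or.inr (Or.inl ⟨s3 x hx h.1, s1 y hy h.2⟩))
      · exact Or.inr (Or.inr (Or.inr (Or.inr ⟨s4 x hx h.1, s2 y hy h.2⟩)))
    clear t0 r10 r20 rA0 rB0 g1 g2 g3 g4 A1' A2' A3' B1' B2' B3' ha hc n1 n2 o1 o2 o3
    rintro (⟨hx, hy, h⟩ | ⟨hx, hy, h⟩) <;> apply fin
    · rcases QA x hx with hx | hx | hx | hx | hx <;> rcases QA y hy with hy | hy | hy | hy | hy <;>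
        simp only [hx.1, hy.1, true_and] <;> omega
    · rcases QB x hx with hx | hx | hx | hx <;> rcases QB y hy with hy | hy | hy | hy <;>
        simp only [hx.1, hy.1, true_and] <;> omega
  · have pu1 : u₁ ∈ A ∧ u₁ ∈ B := by
      have := P1 u₁ hu₁
      rw [t0] at this
      refine ⟨?_, ?_⟩ <;> rcases this with h | h | h | h | h | h <;>
        first | (exfalso; omega) | exact h.2.1 | exact h.2.2.2.1
    have pv1 : v₁ ∈ A ∧ v₁ ∈ B := by
      have := P1 v₁ hv₁
      refine ⟨?_, ?_⟩ <;> rcases this with h | h | h | h | h | h <;>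
        first | (exfalso; omega) | exact h.2.1 | exact h.2.2.2.1
    have pu2 : u₂ ∈ A ∧ u₂ ∈ B := by
      have := P2 u₂ hu₂
      refine ⟨?_, ?_⟩ <;> rcases this with h | h | h | h | h | h <;>
        first | (exfalso; omega) | exact h.2.1 | exact h.2.2.2.1
    have pv2 : v₂ ∈ A ∧ v₂ ∈ B := by
      have := P2 v₂ hv₂
      refine ⟨?_, ?_⟩ <;> rcases this with h | h | h | h | h | h <;>
        first | (exfalso; omega) | exact h.2.1 | exact h.2.2.2.1
    rintro ((⟨hx, hy, h⟩ | ⟨hx, hy, h⟩) | ⟨ex, ey⟩ | ⟨ex, ey⟩ | ⟨ex, ey⟩ | ⟨ex, ey⟩)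
    · clear t0 r10 r20 rA0 rB0 g1 g2 g3 g4 A1' A2' A3' B1' B2' B3' ha hc n1 n2 o1 o2 o3
      rcases P1 x hx with ⟨_, _, _, _, _⟩ | ⟨_, _, _, _⟩ | ⟨_, _, _, _, _⟩ | ⟨_, _, _, _⟩ |
          ⟨_, _, _, _⟩ | ⟨_, _, _, _⟩ <;>
        rcases P1 y hy with ⟨_, _, _, _, _⟩ | ⟨_, _, _, _⟩ | ⟨_, _, _, _, _⟩ | ⟨_, _, _, _⟩ |
          ⟨_, _, _, _⟩ | ⟨_, _, _, _⟩ <;>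
        first
        | (exfalso; omega)
        | exact Or.inl ⟨by assumption, by assumption, by omega⟩
        | exact Or.inr ⟨by assumption, by assumption, by omega⟩
    · clear t0 r10 r20 rA0 rB0 g1 g2 g3 g4 A1' A2' A3' B1' B2' B3' ha hc n1 n2 o1 o2 o3
      rcases P2 x hx with ⟨_, _, _⟩ | ⟨_, _, _, _⟩ | ⟨_, _, _, _, _⟩ | ⟨_, _, _, _⟩ |
          ⟨_, _, _, _, _⟩ | ⟨_, _, _, _⟩ <;>
        rcases P2 y hy with ⟨_, _, _⟩ | ⟨_, _, _, _⟩ | ⟨_, _, _, _, _⟩ | ⟨_, _, _, _⟩ |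
          ⟨_, _, _, _, _⟩ | ⟨_, _, _, _⟩ <;>
        first
        | (exfalso; omega)
        | exact Or.inl ⟨by assumption, by assumption, by omega⟩
        | exact Or.inr ⟨by assumption, by assumption, by omega⟩
    · rw [ex, ey, t0]; exact Or.inr ⟨pu1.2, pu2.2, by omega⟩
    · rw [ex, ey, t0]; exact Or.inl ⟨pu2.1, pu1.1, by omega⟩
    · rw [ex, ey]; exact Or.inl ⟨pv1.1, pv2.1, by omega⟩
    · rw [ex, ey]; exact Or.inr ⟨pv2.2, pv1.2, by
        rcases QB v₂ pv2.2 with h | h | h | h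
        · exact absurd h.1 hv2n
        · exact absurd h.1 hv2n
        · omega
        · omega⟩

/-- (Star subdivision.) Given two mutually independent stars with two distinct
linkable pairs `(u₁, u₂)` and `(v₁, v₂)`, there are two new stars on the same vertices whose
edges are the old edges together with the four directed edges of the two diagonals. -/
theorem star_subdivision (S₁ S₂ : CyclicPolygon) (h₁ : IsStar S₁) (h₂ : IsStar S₂)
    (hind : IndepPolygons S₁ S₂) (u₁ u₂ v₁ v₂ : ℂ)
    (hu₁ : u₁ ∈ S₁.V) (hu₂ : u₂ ∈ S₂.V) (hv₁ : v₁ ∈ S₁.V) (hv₂ : v₂ ∈ S₂.V)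
    (hu : LinkablePair S₁ S₂ u₁ u₂) (hv : LinkablePair S₁ S₂ v₁ v₂)
    (hne : (u₁, u₂) ≠ (v₁, v₂)) :
    ∃ S₁' S₂' : CyclicPolygon, IsStar S₁' ∧ IsStar S₂' ∧
      ((S₁'.V : Set ℂ) ∪ (S₂'.V : Set ℂ)) = ((S₁.V : Set ℂ) ∪ (S₂.V : Set ℂ)) ∧
      ((S₁'.E : Set (ℂ × ℂ)) ∪ (S₂'.E : Set (ℂ × ℂ))) =
        ((S₁.E : Set (ℂ × ℂ)) ∪ (S₂.E : Set (ℂ × ℂ)) ∪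
          {(u₁, u₂), (u₂, u₁), (v₁, v₂), (v₂, v₁)}) := by
  obtain ⟨k, hk, hS1⟩ := h₁
  obtain ⟨m, hm, hS2⟩ := h₂
  have hb : ‖u₁‖ = 1 := S₁.onCircle _ hu₁
  have c1 := S₁.onCircle
  have c2 := S₂.onCircle
  obtain ⟨hu2n, lu1⟩ := link_rank hb hk hS1 (c2 _ hu₂) hu.1.symm hu.2.1
  obtain ⟨hu1n, lu2⟩ := link_rank hb hm hS2 (c1 _ hu₁) hu.1 hu.2.2
  obtain ⟨hv2n, lv1⟩ := link_rank hb hk hS1 (c2 _ hv₂) hv.1.symm hv.2.1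
  obtain ⟨hv1n, lv2⟩ := link_rank hb hm hS2 (c1 _ hv₁) hv.1 hv.2.2
  have n1 := hS1.1
  have n2 := hS2.1
  have tpos : ∀ z, ‖z‖ = 1 → 0 ≤ angT u₁ z := fun z hz => (angT_spec u₁ z hb hz).1
  have t0 : angT u₁ u₁ = 0 := angT_self u₁
  have tne : ∀ z, ‖z‖ = 1 → z ≠ u₁ → 0 < angT u₁ z := fun z hz h => by
    rcases (tpos z hz).lt_or_eq with h' | h'
    · exact h'
    · exact absurd (angT_inj hb hz hb (by rw [t0, h'])) h
  have rz : ∀ V : Finset ℂ, (∀ z ∈ V, ‖z‖ = 1) → rk u₁ V 0 = 0 := by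
    intro V hV
    unfold rk
    rw [Finset.card_eq_zero, Finset.filter_eq_empty_iff]
    intro z hz
    exact not_lt.2 (tpos z (hV z hz))
  have r10 := rz S₁.V c1
  have r20 := rz S₂.V c2
  rw [t0, r10] at lu1
  rw [t0, r20] at lu2
  have hvu : v₁ ≠ u₁ := by
    intro h
    rw [h, t0, r20] at lv2
    have : u₂ = v₂ := rk_inj hb c2 hu₂ hv₂ (by omega)
    exact hne (by rw [h, this])
  have hvu2 : v₂ ≠ u₁ := fun h => hu1n (h ▸ hv₂)
  have o1 := tne v₁ (c1 _ hv₁) hvu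
  have o2 := tne v₂ (c2 _ hv₂) hvu2
  have f1 := rk_succ (b := u₁) (s := angT u₁ v₁) hu₁ (by rw [t0]; exact o1)
  have f2 := rk_succ (b := u₁) (s := angT u₁ v₂) hu₁ (by rw [t0]; exact o2)
  rw [t0, r10] at f1 f2
  have f3 := rk_lt_card (b := u₁) hv₁
  have f4 := rk_le_card u₁ S₁.V (angT u₁ v₂)
  have lt_of : ∀ s t, rk u₁ S₁.V s < rk u₁ S₁.V t → s < t := by
    intro s t h
    by_contra hc
    have := rk_mono u₁ S₁.V (not_lt.1 hc)
    omega
  rcases lv1 with lv1 | lv1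
  · exact subdiv_main S₁ S₂ ⟨k, hk, hS1⟩ ⟨m, hm, hS2⟩ u₁ u₂ v₁ v₂ hu₁ hu₂ hv₁ hv₂ hu hv o1
      (lt_of _ _ (by omega)) (lt_of _ _ (by omega))
  · have a1 : angT u₁ v₂ < angT u₁ u₂ := lt_of _ _ (by omega)
    have a2 : angT u₁ u₂ < angT u₁ v₁ := by
      rcases lt_trichotomy (angT u₁ u₂) (angT u₁ v₁) with h | h | h
      · exact h
      · rw [angT_inj hb (c2 _ hu₂) (c1 _ hv₁) h] at hu2n
        exact absurd hv₁ hu2n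
      · have := rk_succ hv₁ h
        omega
    have hvn := c1 _ hv₁
    have e : ∀ z, z ≠ v₁ → angT v₁ z = posArc v₁ z := fun z hz => by
      unfold angT; rw [if_neg hz]
    have e1 := e u₁ hvu.symm
    have e2 := e v₂ hv.1.symm
    have e3 := e u₂ (fun h => hu2n (h ▸ hv₁))
    obtain ⟨A, B, hA, hB, hV, hE⟩ := subdiv_main S₁ S₂ ⟨k, hk, hS1⟩ ⟨m, hm, hS2⟩ v₁ v₂ u₁ u₂
      hv₁ hv₂ hu₁ hu₂ hv hu
      (by rw [e1]; exact (posArc_spec v₁ u₁ hvn hb).1)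
      (by
        rw [e1, e2, posArc_lt_iff hb hvn hb (c2 _ hv₂)]
        right; left; rw [t0]; exact ⟨o2, by linarith⟩)
      (by
        rw [e2, e3, posArc_lt_iff hb hvn (c2 _ hv₂) (c2 _ hu₂)]
        right; left; exact ⟨a1, a2.le⟩)
    refine ⟨A, B, hA, hB, hV, ?_⟩
    rw [hE]
    congr 1
    clear * -
    ext x
    simp only [Set.mem_insert_iff, Set.mem_singleton_iff]
    tauto

end
end
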